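/- The spectrum of the real Lamé operator L_m = -d²/dx² + m(m+1)k² sn²(x,k) on L²(ℝ) (with 0<k<1 and m a positive integer) has a band structure with exactly m open gaps, and these open gaps are precisely the first m gaps: every point of coexistence of two linearly independent 2K-periodic or 2K-antiperiodic solutions (i.e., every closed gap) is located in the infinite spectral band above the m-th open gap. -/

import Mathlib

open Set Filter

noncomputable section

/-- `sn` is the Jacobi elliptic sine with modulus `k`: characterised as the
unique solution of `sn'' = -(1+k²)sn + 2k² sn³` with `sn 0 = 0`, `sn' 0 = 1`. -/
def IsJacobiSn (k : ℝ) (sn : ℝ → ℝ) : Prop :=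
  ContDiff ℝ 2 sn ∧ sn 0 = 0 ∧ deriv sn 0 = 1 ∧
    ∀ x : ℝ, deriv (deriv sn) x = -(1 + k ^ 2) * sn x + 2 * k ^ 2 * sn x ^ 3

/-- The complete elliptic integral `K = ∫₀^{π/2} dφ/√(1 - k² sin²φ)`;
`2K` is the period of the Lamé potential `m(m+1)k² sn²(x,k)`. -/
def ellK (k : ℝ) : ℝ := ∫ φ in (0:ℝ)..(Real.pi / 2), 1 / Real.sqrt (1 - k ^ 2 * Real.sin φ ^ 2)

/-- The Lamé potential `q(x) = m(m+1)k² sn²(x,k)`. -/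
def lamePot (m : ℕ) (k : ℝ) (sn : ℝ → ℝ) : ℝ → ℝ :=
  fun x => (m * (m + 1) : ℝ) * k ^ 2 * sn x ^ 2

/-- `ψ` is a nonzero solution of `-ψ'' + qψ = λψ` with `ψ(x+T) = s·ψ(x)`
(`s = 1`: periodic; `s = -1`: antiperiodic). -/
def IsFloquetSolution (q : ℝ → ℝ) (T lam s : ℝ) (ψ : ℝ → ℝ) : Prop :=
  ψ ≠ 0 ∧ ContDiff ℝ 2 ψ ∧
    (∀ x : ℝ, -deriv (deriv ψ) x + q x * ψ x = lam * ψ x) ∧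
    ∀ x : ℝ, ψ (x + T) = s * ψ x

/-- `λ` belongs to the `T`-periodic spectrum. -/
def IsPeriodicEV (q : ℝ → ℝ) (T lam : ℝ) : Prop :=
  ∃ ψ : ℝ → ℝ, IsFloquetSolution q T lam 1 ψ

/-- `λ` belongs to the `T`-antiperiodic spectrum. -/
def IsAntiperiodicEV (q : ℝ → ℝ) (T lam : ℝ) : Prop :=
  ∃ ψ : ℝ → ℝ, IsFloquetSolution q T lam (-1) ψ

/-- Coexistence of two linearly independent `T`-periodic solutions at `λ`
(i.e. `λ` is a periodic eigenvalue of multiplicity 2). -/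
def IsDoublePeriodicEV (q : ℝ → ℝ) (T lam : ℝ) : Prop :=
  ∃ ψ₁ ψ₂ : ℝ → ℝ, LinearIndependent ℝ ![ψ₁, ψ₂] ∧
    IsFloquetSolution q T lam 1 ψ₁ ∧ IsFloquetSolution q T lam 1 ψ₂

/-- Coexistence of two linearly independent `T`-antiperiodic solutions at `λ`. -/
def IsDoubleAntiperiodicEV (q : ℝ → ℝ) (T lam : ℝ) : Prop :=
  ∃ ψ₁ ψ₂ : ℝ → ℝ, LinearIndependent ℝ ![ψ₁, ψ₂] ∧
    IsFloquetSolution q T lam (-1) ψ₁ ∧ IsFloquetSolution q T lam (-1) ψ₂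

/-! ### Prüfer angle -/

/-- The right-hand side of the Prüfer equation. -/
def prF (Q : ℝ → ℝ) (x θ : ℝ) : ℝ := Real.cos θ ^ 2 + Q x * Real.sin θ ^ 2

lemma sin_sq_sub_sin_sq (a b : ℝ) :
    Real.sin a ^ 2 - Real.sin b ^ 2 = Real.sin (b + a) * Real.sinc (a - b) * (a - b) := by
  have h : Real.sinc (a - b) * (a - b) = Real.sin (a - b) := by
    by_cases h : a - b = 0
    · simp [h]
    · rw [Real.sinc_of_ne_zero h]; field_simp
  rw [mul_assoc, h, Real.sin_add, Real.sin_sub]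
  have h1 := Real.sin_sq_add_cos_sq a
  have h2 := Real.sin_sq_add_cos_sq b
  linear_combination (Real.sin b ^ 2) * h1 - (Real.sin a ^ 2) * h2

lemma prF_sub (Q : ℝ → ℝ) (x a b : ℝ) :
    prF Q x a - prF Q x b = (Q x - 1) * (Real.sin (b + a) * Real.sinc (a - b)) * (a - b) := by
  have h := sin_sq_sub_sin_sq a b
  have h1 := Real.sin_sq_add_cos_sq a
  have h2 := Real.sin_sq_add_cos_sq b
  unfold prF
  linear_combination (Q x - 1) * h + h1 - h2

lemma prF_coef_bound {Q : ℝ → ℝ} {B : ℝ} (hB : ∀ x, |Q x| ≤ B) (x a b : ℝ) :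
    |(Q x - 1) * (Real.sin (b + a) * Real.sinc (a - b))| ≤ B + 1 := by
  have h1 := Real.abs_sin_le_one (b + a)
  have h2 := Real.abs_sinc_le_one (a - b)
  have h3 : |Q x - 1| ≤ B + 1 := by
    have := abs_le.1 (hB x)
    rw [abs_le]; constructor <;> linarith
  have h4 : 0 ≤ B + 1 := (abs_nonneg _).trans h3
  rw [abs_mul, abs_mul]
  calc _ ≤ (B + 1) * (1 * 1) := by gcongr
    _ = _ := by ring

lemma prF_lip {Q : ℝ → ℝ} {B : ℝ} (hB0 : 0 ≤ B) (hB : ∀ x, |Q x| ≤ B) (x : ℝ) :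
    LipschitzWith (Real.toNNReal (B + 1)) (prF Q x) := by
  apply LipschitzWith.of_dist_le_mul
  intro a b
  rw [Real.dist_eq, Real.dist_eq, prF_sub, abs_mul, Real.coe_toNNReal _ (by linarith)]
  gcongr
  exact prF_coef_bound hB x a b

lemma prF_bound {Q : ℝ → ℝ} {B : ℝ} (hB : ∀ x, |Q x| ≤ B) (x θ : ℝ) :
    |prF Q x θ| ≤ B + 1 := by
  have hB' := abs_le.1 (hB x)
  have h1 := Real.sin_sq_add_cos_sq θ
  have h2 := sq_nonneg (Real.sin θ)
  have h3 := sq_nonneg (Real.cos θ)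
  unfold prF
  rw [abs_le]; constructor <;> nlinarith

lemma pruefer_local {Q : ℝ → ℝ} (hQ : Continuous Q) {B : ℝ} (hB0 : 0 ≤ B)
    (hB : ∀ x, |Q x| ≤ B) (θ₀ T : ℝ) (hT : 0 < T) :
    ∃ θ : ℝ → ℝ, θ 0 = θ₀ ∧ ∀ x ∈ Ioo (-T) T, HasDerivAt θ (prF Q x (θ x)) x := by
  have h : IsPicardLindelof (prF Q) (⟨0, by constructor <;> linarith⟩ : Icc (-T) T) θ₀
      (Real.toNNReal ((B + 1) * T)) 0 (Real.toNNReal (B + 1)) (Real.toNNReal (B + 1)) := by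
    refine ⟨fun t _ => (prF_lip hB0 hB t).lipschitzOnWith, fun x _ => ?_, fun t _ x _ => ?_, ?_⟩
    · unfold prF; fun_prop
    · rw [Real.norm_eq_abs, Real.coe_toNNReal _ (by linarith)]; exact prF_bound hB t x
    · rw [Real.coe_toNNReal _ (by linarith), Real.coe_toNNReal _ (by positivity)]
      simp
  obtain ⟨θ, h0, h1⟩ := h.exists_eq_forall_mem_Icc_hasDerivWithinAt₀
  exact ⟨θ, h0, fun x hx => (h1 x (Ioo_subset_Icc_self hx)).hasDerivAt (Icc_mem_nhds hx.1 hx.2)⟩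

lemma pruefer_exists {Q : ℝ → ℝ} (hQ : Continuous Q) {B : ℝ} (hB0 : 0 ≤ B)
    (hB : ∀ x, |Q x| ≤ B) (θ₀ : ℝ) :
    ∃ θ : ℝ → ℝ, θ 0 = θ₀ ∧ ∀ x, HasDerivAt θ (prF Q x (θ x)) x := by
  have H := fun n : ℕ => pruefer_local hQ hB0 hB θ₀ ((n : ℝ) + 1) (by positivity)
  choose θ h0 h1 using H
  have key : ∀ n n' : ℕ, n ≤ n' → EqOn (θ n) (θ n') (Ioo (-((n : ℝ) + 1)) (n + 1)) := by
    intro n n' hn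
    have hn' : (n : ℝ) ≤ n' := by exact_mod_cast hn
    have hn0 : (0 : ℝ) ≤ n := by positivity
    refine ODE_solution_unique_of_mem_Ioo (v := prF Q) (s := fun _ => univ) (t₀ := 0)
      (fun t _ => (prF_lip hB0 hB t).lipschitzOnWith) ⟨by linarith, by linarith⟩
      (fun t ht => ⟨h1 n t ht, trivial⟩)
      (fun t ht => ⟨h1 n' t ⟨by linarith [ht.1], by linarith [ht.2]⟩, trivial⟩)
      (by rw [h0, h0])
  let N : ℝ → ℕ := fun x => ⌈|x|⌉₊
  refine ⟨fun x => θ (N x) x, by simp [h0], fun x => ?_⟩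
  have hx : x ∈ Ioo (-((N x : ℝ) + 1)) (N x + 1) := by
    have := Nat.le_ceil |x|
    have h2 := abs_le.1 this
    constructor <;> simp only [N] <;> linarith [h2.1, h2.2]
  refine (h1 (N x) x hx).congr_of_eventuallyEq ?_
  filter_upwards [Ioo_mem_nhds hx.1 hx.2] with y hy
  have hy' : y ∈ Ioo (-((N y : ℝ) + 1)) (N y + 1) := by
    have := Nat.le_ceil |y|
    have h2 := abs_le.1 this
    constructor <;> simp only [N] <;> linarith [h2.1, h2.2]
  rcases le_total (N y) (N x) with h | h
  · exact key _ _ h hy'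
  · exact (key _ _ h hy).symm

/-- `θ` is a global Prüfer angle for coefficient `Q`. -/
def IsPr (Q : ℝ → ℝ) (θ : ℝ → ℝ) : Prop := ∀ x, HasDerivAt θ (prF Q x (θ x)) x

lemma IsPr.cont {Q θ : ℝ → ℝ} (h : IsPr Q θ) : Continuous θ :=
  continuous_iff_continuousAt.2 fun x => (h x).continuousAt

/-- The difference of two Prüfer angles, multiplied by an integrating factor. -/
lemma pr_diff {Q₁ Q₂ θ₁ θ₂ : ℝ → ℝ} (hQ₂ : Continuous Q₂) (h₁ : IsPr Q₁ θ₁) (h₂ : IsPr Q₂ θ₂) :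
    ∃ E : ℝ → ℝ, (∀ x, 0 < E x) ∧ E 0 = 1 ∧
      ∀ x, HasDerivAt (fun x => (θ₂ x - θ₁ x) * E x)
        ((Q₂ x - Q₁ x) * Real.sin (θ₁ x) ^ 2 * E x) x := by
  have c1 := h₁.cont
  have c2 := h₂.cont
  let g : ℝ → ℝ := fun x => (Q₂ x - 1) * (Real.sin (θ₁ x + θ₂ x) * Real.sinc (θ₂ x - θ₁ x))
  have hg : Continuous g := by
    have := Real.continuous_sinc
    fun_prop
  refine ⟨fun x => Real.exp (-∫ t in (0:ℝ)..x, g t), fun x => Real.exp_pos _, by simp, fun x => ?_⟩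
  have hG : HasDerivAt (fun x => ∫ t in (0:ℝ)..x, g t) (g x) x :=
    intervalIntegral.integral_hasDerivAt_right (hg.intervalIntegrable _ _)
      (hg.stronglyMeasurableAtFilter _ _) hg.continuousAt
  refine (((h₂ x).sub (h₁ x)).mul hG.neg.exp).congr_deriv ?_
  have e := prF_sub Q₂ x (θ₂ x) (θ₁ x)
  have e2 : prF Q₂ x (θ₁ x) - prF Q₁ x (θ₁ x) = (Q₂ x - Q₁ x) * Real.sin (θ₁ x) ^ 2 := by
    unfold prF; ring
  simp only [g, Pi.neg_apply, Pi.sub_apply]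
  linear_combination (Real.exp (-∫ t in (0:ℝ)..x, g t)) * (e + e2)

/-- Ordering of Prüfer angles for the same coefficient. -/
lemma pr_lt {Q θ₁ θ₂ : ℝ → ℝ} (hQ : Continuous Q) (h₁ : IsPr Q θ₁) (h₂ : IsPr Q θ₂)
    (h0 : θ₁ 0 < θ₂ 0) (x : ℝ) : θ₁ x < θ₂ x := by
  obtain ⟨E, hE, hE0, hd⟩ := pr_diff hQ h₁ h₂
  have hc := is_const_of_deriv_eq_zero (f := fun x => (θ₂ x - θ₁ x) * E x)
    (fun x => (hd x).differentiableAt) (fun x => by rw [(hd x).deriv]; simp) x 0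
  simp only [hE0, mul_one] at hc
  have := hE x
  by_contra hcon
  push Not at hcon
  nlinarith

lemma pr_le {Q₁ Q₂ θ₁ θ₂ : ℝ → ℝ} (hQ₂ : Continuous Q₂) (h₁ : IsPr Q₁ θ₁)
    (h₂ : IsPr Q₂ θ₂) (h0 : θ₁ 0 = θ₂ 0) (hQ : ∀ x, Q₁ x < Q₂ x) {x : ℝ} (hx : 0 < x) :
    θ₁ x < θ₂ x := by
  obtain ⟨E, hE, hE0, hd⟩ := pr_diff hQ₂ h₁ h₂
  have hmono : Monotone (fun x => (θ₂ x - θ₁ x) * E x) :=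
    monotone_of_deriv_nonneg (fun x => (hd x).differentiableAt) (fun x => by
      rw [(hd x).deriv]
      have := hE x
      have := hQ x
      have : 0 ≤ Q₂ x - Q₁ x := by linarith
      positivity)
  by_contra hcon
  push Not at hcon
  have hz : ∀ y ∈ Icc 0 x, (θ₂ y - θ₁ y) * E y = 0 := by
    intro y hy
    have h1 := hmono hy.1
    have h2 := hmono hy.2
    simp only [h0, sub_self, zero_mul] at h1
    have h3 : (θ₂ x - θ₁ x) * E x ≤ 0 := mul_nonpos_of_nonpos_of_nonneg (by linarith) (hE x).le
    simp only at h2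
    linarith
  have hsin : ∀ y ∈ Ioo 0 x, Real.sin (θ₁ y) = 0 := by
    intro y hy
    have hev : (fun x => (θ₂ x - θ₁ x) * E x) =ᶠ[nhds y] fun _ => 0 := by
      filter_upwards [Ioo_mem_nhds hy.1 hy.2] with z hz'
      exact hz z (Ioo_subset_Icc_self hz')
    have h1 := (hd y).unique ((hasDerivAt_const y (0:ℝ)).congr_of_eventuallyEq hev)
    have := hQ y
    have h2 : (Q₂ y - Q₁ y) ≠ 0 := by linarith
    have h3 := (hE y).ne'
    simpa [h2, h3] using h1
  have hy : x / 2 ∈ Ioo 0 x := ⟨by linarith, by linarith⟩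
  have hev : (fun y => Real.sin (θ₁ y)) =ᶠ[nhds (x/2)] fun _ => 0 := by
    filter_upwards [Ioo_mem_nhds hy.1 hy.2] with z hz'
    exact hsin z hz'
  have h1 := ((h₁ (x/2)).sin).unique ((hasDerivAt_const _ (0:ℝ)).congr_of_eventuallyEq hev)
  have h2 := hsin _ hy
  have h3 := Real.sin_sq_add_cos_sq (θ₁ (x/2))
  unfold prF at h1
  rw [h2] at h1 h3
  have h4 : Real.cos (θ₁ (x/2)) ^ 2 = 1 := by linarith
  rw [h4] at h1
  have h5 : Real.cos (θ₁ (x/2)) = 0 := by linarith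
  rw [h5] at h4
  norm_num at h4

lemma pr_diff' {Q θ α α' : ℝ → ℝ} (hQ : Continuous Q) (h : IsPr Q θ)
    (hα : ∀ x, HasDerivAt α (α' x) x) :
    ∃ E : ℝ → ℝ, (∀ x, 0 < E x) ∧
      ∀ x, HasDerivAt (fun x => (θ x - α x) * E x)
        ((prF Q x (α x) - α' x) * E x) x := by
  have c1 := h.cont
  have c2 : Continuous α := continuous_iff_continuousAt.2 fun x => (hα x).continuousAt
  let g : ℝ → ℝ := fun x => (Q x - 1) * (Real.sin (α x + θ x) * Real.sinc (θ x - α x))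
  have hg : Continuous g := by
    have := Real.continuous_sinc
    fun_prop
  refine ⟨fun x => Real.exp (-∫ t in (0:ℝ)..x, g t), fun x => Real.exp_pos _, fun x => ?_⟩
  have hG : HasDerivAt (fun x => ∫ t in (0:ℝ)..x, g t) (g x) x :=
    intervalIntegral.integral_hasDerivAt_right (hg.intervalIntegrable _ _)
      (hg.stronglyMeasurableAtFilter _ _) hg.continuousAt
  refine (((h x).sub (hα x)).mul hG.neg.exp).congr_deriv ?_
  have e := prF_sub Q x (θ x) (α x)
  simp only [g, Pi.neg_apply, Pi.sub_apply]
  linear_combination (Real.exp (-∫ t in (0:ℝ)..x, g t)) * e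

lemma pr_gt_const {Q θ : ℝ → ℝ} (hQ : Continuous Q) (h : IsPr Q θ) (a : ℝ)
    (ha : ∀ x, 0 < prF Q x a) (h0 : a ≤ θ 0) {x : ℝ} (hx : 0 < x) : a < θ x := by
  obtain ⟨E, hE, hd⟩ := pr_diff' (α := fun _ => a) (α' := fun _ => 0) hQ h
    (fun x => hasDerivAt_const _ _)
  have hmono : StrictMono (fun x => (θ x - a) * E x) :=
    strictMono_of_deriv_pos (fun x => by
      rw [(hd x).deriv]
      have := hE x
      have := ha x
      simp only [sub_zero]
      positivity)
  have h1 := hmono hx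
  simp only at h1
  have h2 : 0 ≤ (θ 0 - a) * E 0 := mul_nonneg (by linarith) (hE 0).le
  have h3 : 0 < (θ x - a) * E x := by linarith
  have h4 := (mul_pos_iff_of_pos_right (hE x)).1 h3
  linarith

lemma pr_lt_const {Q θ : ℝ → ℝ} (hQ : Continuous Q) (h : IsPr Q θ) (a : ℝ)
    (ha : ∀ x, prF Q x a < 0) (h0 : θ 0 ≤ a) {x : ℝ} (hx : 0 < x) : θ x < a := by
  obtain ⟨E, hE, hd⟩ := pr_diff' (α := fun _ => a) (α' := fun _ => 0) hQ h
    (fun x => hasDerivAt_const _ _)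
  have hmono : StrictAnti (fun x => (θ x - a) * E x) :=
    strictAnti_of_deriv_neg (fun x => by
      rw [(hd x).deriv]
      have := hE x
      have := ha x
      simp only [sub_zero]
      nlinarith)
  have h1 := hmono hx
  simp only at h1
  have h2 : (θ 0 - a) * E 0 ≤ 0 := mul_nonpos_of_nonpos_of_nonneg (by linarith) (hE 0).le
  have h3 : (θ x - a) * E x < 0 := by linarith
  by_contra hcon
  push Not at hcon
  nlinarith [hE x]

lemma IsPr.add_pi {Q θ : ℝ → ℝ} (h : IsPr Q θ) : IsPr Q (fun x => θ x + Real.pi) := by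
  intro x
  refine ((h x).add_const Real.pi).congr_deriv ?_
  simp [prF, Real.cos_add_pi, Real.sin_add_pi]

/-- Linear solution attached to a Prüfer angle. -/
lemma pr_linear {Q θ : ℝ → ℝ} (hQ : Continuous Q) (h : IsPr Q θ) :
    ∃ r : ℝ → ℝ, (∀ x, 0 < r x) ∧ r 0 = 1 ∧
      (∀ x, HasDerivAt (fun x => r x * Real.sin (θ x)) (r x * Real.cos (θ x)) x) ∧
      (∀ x, HasDerivAt (fun x => r x * Real.cos (θ x)) (-Q x * (r x * Real.sin (θ x))) x) := by
  have c1 := h.cont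
  let g : ℝ → ℝ := fun x => (1 - Q x) * (Real.sin (θ x) * Real.cos (θ x))
  have hg : Continuous g := by fun_prop
  have hr : ∀ x, HasDerivAt (fun x => Real.exp (∫ t in (0:ℝ)..x, g t))
      (Real.exp (∫ t in (0:ℝ)..x, g t) * g x) x := fun x => by
    have hG : HasDerivAt (fun x => ∫ t in (0:ℝ)..x, g t) (g x) x :=
      intervalIntegral.integral_hasDerivAt_right (hg.intervalIntegrable _ _)
        (hg.stronglyMeasurableAtFilter _ _) hg.continuousAt
    exact hG.exp
  refine ⟨fun x => Real.exp (∫ t in (0:ℝ)..x, g t), fun x => Real.exp_pos _, by simp, fun x => ?_,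
    fun x => ?_⟩
  · refine ((hr x).mul (h x).sin).congr_deriv ?_
    have := Real.sin_sq_add_cos_sq (θ x)
    simp only [g, prF]
    linear_combination (Real.exp (∫ t in (0:ℝ)..x, g t)) * Real.cos (θ x) * this
  · refine ((hr x).mul (h x).cos).congr_deriv ?_
    have := Real.sin_sq_add_cos_sq (θ x)
    simp only [g, prF]
    linear_combination (-Q x) * (Real.exp (∫ t in (0:ℝ)..x, g t)) * Real.sin (θ x) * this

lemma pr_growth {Q θ : ℝ → ℝ} (h : IsPr Q θ) (h0 : θ 0 = 0) {N : ℝ} (hN : 0 < N)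
    (hQN : ∀ x, N ^ 2 ≤ Q x) {x : ℝ} (hx : 0 ≤ x) : N * x - Real.pi / 2 ≤ θ x := by
  let om : ℝ → ℝ := fun x => θ x + Real.arctan ((N - 1) * (Real.sin (θ x) * Real.cos (θ x)) /
    (Real.cos (θ x) ^ 2 + N * Real.sin (θ x) ^ 2))
  have hpos : ∀ t : ℝ, 0 < Real.cos t ^ 2 + N * Real.sin t ^ 2 := by
    intro t
    have h1 := Real.sin_sq_add_cos_sq t
    by_cases hs : Real.sin t = 0
    · rw [hs] at h1 ⊢; nlinarith
    · have : 0 < N * Real.sin t ^ 2 := by positivity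
      have := sq_nonneg (Real.cos t)
      linarith
  have hpos2 : ∀ t : ℝ, 0 < Real.cos t ^ 2 + N ^ 2 * Real.sin t ^ 2 := by
    intro t
    have h1 := Real.sin_sq_add_cos_sq t
    by_cases hs : Real.sin t = 0
    · rw [hs] at h1 ⊢; nlinarith
    · have : 0 < N ^ 2 * Real.sin t ^ 2 := by positivity
      have := sq_nonneg (Real.cos t)
      linarith
  have hd : ∀ x, HasDerivAt om (prF Q x (θ x) * (N / (Real.cos (θ x) ^ 2 + N ^ 2 * Real.sin (θ x) ^ 2))) x := by
    intro x
    have hB := (hpos (θ x)).ne'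
    have hB2 := (hpos2 (θ x)).ne'
    have hs := (h x).sin
    have hc := (h x).cos
    have hA := ((hs.mul hc).const_mul (N - 1)).div
      ((hc.pow 2).add ((hs.pow 2).const_mul N)) hB
    refine ((h x).add hA.arctan).congr_deriv ?_
    have hsc := Real.sin_sq_add_cos_sq (θ x)
    simp only [Pi.mul_apply, Pi.div_apply, Pi.add_apply, Pi.pow_apply]
    generalize prF Q x (θ x) = F
    generalize Real.sin (θ x) = s at *
    generalize Real.cos (θ x) = c at *
    have hBB : (c ^ 2 + N * s ^ 2) ^ 2 + ((N - 1) * (s * c)) ^ 2 = c ^ 2 + N ^ 2 * s ^ 2 := by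
      linear_combination (c ^ 2 + N ^ 2 * s ^ 2) * hsc
    have e1 : 1 + ((N - 1) * (s * c) / (c ^ 2 + N * s ^ 2)) ^ 2
        = (c ^ 2 + N ^ 2 * s ^ 2) / (c ^ 2 + N * s ^ 2) ^ 2 := by
      rw [← hBB]; field_simp
    rw [e1]
    field_simp
    push_cast
    have e2 : c ^ 2 = 1 - s ^ 2 := by linarith
    linear_combination F * ((N-1)*(c^2 - N*s^2) + N) * hsc
  have hmono : Monotone (fun x => om x - N * x) := by
    refine monotone_of_deriv_nonneg (fun x => ((hd x).sub ((hasDerivAt_id x).const_mul N)).differentiableAt)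
      (fun x => ?_)
    have := ((hd x).sub ((hasDerivAt_id x).const_mul N)).deriv
    simp only [Pi.sub_def, id] at this
    rw [this]
    have hB2 := hpos2 (θ x)
    have : Real.cos (θ x) ^ 2 + N ^ 2 * Real.sin (θ x) ^ 2 ≤ prF Q x (θ x) := by
      unfold prF
      have := hQN x
      gcongr
    have h3 : N ≤ prF Q x (θ x) * (N / (Real.cos (θ x) ^ 2 + N ^ 2 * Real.sin (θ x) ^ 2)) := by
      rw [mul_div_assoc', le_div_iff₀ hB2]
      nlinarith
    linarith
  have h1 := hmono hx
  simp only [om, h0] at h1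
  simp at h1
  have h2 := Real.arctan_lt_pi_div_two ((N - 1) * (Real.sin (θ x) * Real.cos (θ x)) /
    (Real.cos (θ x) ^ 2 + N * Real.sin (θ x) ^ 2))
  linarith

lemma pr_cont {q : ℝ → ℝ} {B : ℝ} (hB : ∀ x, |q x| ≤ B) (θ : ℝ → ℝ → ℝ)
    (h : ∀ l, IsPr (fun x => l - q x) (θ l)) {θ₀ : ℝ} (h0 : ∀ l, θ l 0 = θ₀) {x : ℝ} (hx : 0 ≤ x) :
    Continuous (fun l => θ l x) := by
  rw [continuous_iff_continuousAt]
  intro l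
  have hB0 : 0 ≤ B := (abs_nonneg _).trans (hB 0)
  have hBl : ∀ y, |l - q y| ≤ |l| + B := fun y => (abs_sub _ _).trans (by linarith [hB y])
  have key : ∀ μ, dist (θ μ x) (θ l x) ≤
      gronwallBound 0 (Real.toNNReal (|l| + B + 1)) (|μ - l|) x := by
    intro μ
    have := dist_le_of_approx_trajectories_ODE (v := prF (fun x => l - q x)) (a := 0) (b := x)
      (f := θ μ) (g := θ l) (f' := fun t => prF (fun x => μ - q x) t (θ μ t))
      (g' := fun t => prF (fun x => l - q x) t (θ l t))
      (εf := |μ - l|) (εg := 0) (δ := 0) (fun t => prF_lip (by positivity) hBl t)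
      (h μ).cont.continuousOn (fun t _ => (h μ t).hasDerivWithinAt) (fun t _ => by
        rw [Real.dist_eq]
        have : prF (fun x => μ - q x) t (θ μ t) - prF (fun x => l - q x) t (θ μ t)
          = (μ - l) * Real.sin (θ μ t) ^ 2 := by unfold prF; ring
        rw [this, abs_mul]
        have h1 : |Real.sin (θ μ t) ^ 2| ≤ 1 := by
          rw [abs_of_nonneg (sq_nonneg _)]; exact Real.sin_sq_le_one _
        nlinarith [abs_nonneg (μ - l)])
      (h l).cont.continuousOn (fun t _ => (h l t).hasDerivWithinAt) (fun t _ => by simp)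
      (by simp [h0]) x ⟨hx, le_rfl⟩
    simpa using this
  rw [ContinuousAt, tendsto_iff_dist_tendsto_zero]
  have hlim : Tendsto (fun μ => gronwallBound 0 (Real.toNNReal (|l| + B + 1)) (|μ - l|) x)
      (nhds l) (nhds 0) := by
    have h1 := gronwallBound_continuous_ε 0 (Real.toNNReal (|l| + B + 1)) x
    have h2 : Continuous (fun μ => gronwallBound 0 (Real.toNNReal (|l| + B + 1)) (|μ - l|) x) :=
      h1.comp (by fun_prop)
    have h3 := h2.tendsto l
    simpa [gronwallBound_ε0_δ0] using h3
  exact squeeze_zero (fun _ => dist_nonneg) key hlim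

/-- Uniqueness for second order linear equations. -/
lemma lin_uniq {y z g : ℝ → ℝ} (hg : Continuous g) (hy : ∀ x, HasDerivAt y (z x) x)
    (hz : ∀ x, HasDerivAt z (g x * y x) x) {x₀ : ℝ} (y0 : y x₀ = 0) (z0 : z x₀ = 0) (x : ℝ) :
    y x = 0 ∧ z x = 0 := by
  let h : ℝ → ℝ := fun x => |1 + g x|
  have hh : Continuous h := by fun_prop
  have hH : ∀ x, HasDerivAt (fun x => ∫ t in (0:ℝ)..x, h t) (h x) x := fun x =>
    intervalIntegral.integral_hasDerivAt_right (hh.intervalIntegrable _ _)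
        (hh.stronglyMeasurableAtFilter _ _) hh.continuousAt
  have hE : ∀ x, HasDerivAt (fun x => y x ^ 2 + z x ^ 2) (2 * (1 + g x) * (y x * z x)) x := fun x => by
    refine (((hy x).pow 2).add ((hz x).pow 2)).congr_deriv ?_
    push_cast; ring
  have hb : ∀ x, |2 * (1 + g x) * (y x * z x)| ≤ h x * (y x ^ 2 + z x ^ 2) := fun x => by
    have : 2 * |y x * z x| ≤ y x ^ 2 + z x ^ 2 := by
      rw [abs_mul]
      nlinarith [sq_nonneg (|y x| - |z x|), sq_abs (y x), sq_abs (z x)]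
    rw [abs_mul, abs_mul, abs_two]
    have h0 : 0 ≤ h x := abs_nonneg _
    calc 2 * |1 + g x| * |y x * z x| = h x * (2 * |y x * z x|) := by simp only [h]; ring
      _ ≤ _ := by gcongr
  have hzero : y x ^ 2 + z x ^ 2 ≤ 0 := by
    rcases le_total x₀ x with hx | hx
    · have hd : ∀ x, HasDerivAt (fun x => (y x ^ 2 + z x ^ 2) * Real.exp (-∫ t in (0:ℝ)..x, h t))
          ((2 * (1 + g x) * (y x * z x) - h x * (y x ^ 2 + z x ^ 2)) *
            Real.exp (-∫ t in (0:ℝ)..x, h t)) x := fun x => by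
        refine ((hE x).mul (hH x).neg.exp).congr_deriv ?_
        simp only [Pi.neg_apply]; ring
      have hm := antitone_of_deriv_nonpos (fun x => (hd x).differentiableAt) (fun x => by
        rw [(hd x).deriv]
        have := (abs_le.1 (hb x)).2
        exact mul_nonpos_of_nonpos_of_nonneg (by linarith) (Real.exp_pos _).le) hx
      simp only [y0, z0] at hm
      norm_num at hm
      exact nonpos_of_mul_nonpos_left hm (Real.exp_pos _)
    · have hd : ∀ x, HasDerivAt (fun x => (y x ^ 2 + z x ^ 2) * Real.exp (∫ t in (0:ℝ)..x, h t))
          ((2 * (1 + g x) * (y x * z x) + h x * (y x ^ 2 + z x ^ 2)) *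
            Real.exp (∫ t in (0:ℝ)..x, h t)) x := fun x => by
        refine ((hE x).mul (hH x).exp).congr_deriv ?_
        ring
      have hm := monotone_of_deriv_nonneg (fun x => (hd x).differentiableAt) (fun x => by
        rw [(hd x).deriv]
        have := (abs_le.1 (hb x)).1
        exact mul_nonneg (by linarith) (Real.exp_pos _).le) hx
      simp only [y0, z0] at hm
      norm_num at hm
      exact nonpos_of_mul_nonpos_left hm (Real.exp_pos _)
  constructor <;> nlinarith [sq_nonneg (y x), sq_nonneg (z x)]

structure Jac (k K : ℝ) (s c d : ℝ → ℝ) : Prop where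
  hk0 : 0 < k
  hk1 : k < 1
  Kpos : 0 < K
  hs : ∀ x, HasDerivAt s (c x * d x) x
  hc : ∀ x, HasDerivAt c (-(s x * d x)) x
  hd : ∀ x, HasDerivAt d (-(k ^ 2 * s x * c x)) x
  sc : ∀ x, s x ^ 2 + c x ^ 2 = 1
  dd : ∀ x, d x ^ 2 = 1 - k ^ 2 * s x ^ 2
  dpos : ∀ x, 0 < d x
  s_odd : ∀ x, s (-x) = - s x
  c_even : ∀ x, c (-x) = c x
  d_even : ∀ x, d (-x) = d x
  s_per : ∀ x, s (x + 2 * K) = - s x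
  c_per : ∀ x, c (x + 2 * K) = - c x
  d_per : ∀ x, d (x + 2 * K) = d x
  c_pos : ∀ x, -K < x → x < K → 0 < c x
  c_K : c (-K) = 0

lemma jac_exists {k : ℝ} (hk0 : 0 < k) (hk1 : k < 1) : ∃ s c d, Jac k (ellK k) s c d := by
  let Δ : ℝ → ℝ := fun φ => Real.sqrt (1 - k ^ 2 * Real.sin φ ^ 2)
  have hrad : ∀ φ, 0 < 1 - k ^ 2 * Real.sin φ ^ 2 := fun φ => by
    have := Real.sin_sq_le_one φ
    have : k ^ 2 < 1 := by nlinarith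
    nlinarith [sq_nonneg k, sq_nonneg (Real.sin φ)]
  have hΔ : ∀ φ, 0 < Δ φ := fun φ => Real.sqrt_pos.2 (hrad φ)
  have hΔ2 : ∀ φ, Δ φ ^ 2 = 1 - k ^ 2 * Real.sin φ ^ 2 := fun φ => Real.sq_sqrt (hrad φ).le
  have hΔ1 : ∀ φ, Δ φ ≤ 1 := fun φ => by
    have := hΔ2 φ
    nlinarith [hΔ φ, sq_nonneg (k * Real.sin φ)]
  have hΔc : Continuous Δ := by simp only [Δ]; fun_prop
  let F : ℝ → ℝ := fun φ => ∫ t in (0:ℝ)..φ, 1 / Δ t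
  have hinv : Continuous (fun t => 1 / Δ t) := continuous_const.div hΔc (fun x => (hΔ x).ne')
  have hF : ∀ φ, HasDerivAt F (1 / Δ φ) φ := fun φ =>
    intervalIntegral.integral_hasDerivAt_right (hinv.intervalIntegrable _ _)
        (hinv.stronglyMeasurableAtFilter _ _) hinv.continuousAt
  have hF0 : F 0 = 0 := by simp [F]
  have hFK : F (Real.pi / 2) = ellK k := rfl
  have hmono : StrictMono F := strictMono_of_deriv_pos (fun x => by
    rw [(hF x).deriv]; exact one_div_pos.2 (hΔ x))
  have hcont : Continuous F := continuous_iff_continuousAt.2 fun x => (hF x).continuousAt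
  have hmono2 : Monotone (fun φ => F φ - φ) :=
    monotone_of_deriv_nonneg (fun x => ((hF x).sub (hasDerivAt_id x)).differentiableAt) (fun x => by
      have := ((hF x).sub (hasDerivAt_id x)).deriv
      simp only [Pi.sub_def, id] at this
      rw [this, sub_nonneg, le_div_iff₀ (hΔ x)]
      linarith [hΔ1 x])
  have hodd : ∀ φ, F (-φ) = - F φ := by
    intro φ
    have hd : ∀ x, HasDerivAt (fun x => F (-x) + F x) 0 x := fun x => by
      refine (((hF (-x)).comp x (hasDerivAt_neg x)).add (hF x)).congr_deriv ?_
      simp [Δ]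
    have := is_const_of_deriv_eq_zero (fun x => (hd x).differentiableAt) (fun x => (hd x).deriv) φ 0
    simp [hF0] at this
    linarith
  have hpi : ∀ φ, F (φ + Real.pi) = F φ + 2 * ellK k := by
    intro φ
    have hd : ∀ x, HasDerivAt (fun x => F (x + Real.pi) - F x) 0 x := fun x => by
      refine (((hF (x + Real.pi)).comp x ((hasDerivAt_id x).add_const Real.pi)).sub (hF x)).congr_deriv ?_
      simp [Δ, Real.sin_add_pi]
    have := is_const_of_deriv_eq_zero (fun x => (hd x).differentiableAt) (fun x => (hd x).deriv) φ
      (-(Real.pi / 2))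
    rw [hodd, hFK, show -(Real.pi / 2) + Real.pi = Real.pi / 2 by ring, hFK] at this
    linarith
  have hsurj : Function.Surjective F := by
    refine hcont.surjective ?_ ?_
    · refine tendsto_atTop_mono' _ ?_ tendsto_id
      filter_upwards [eventually_ge_atTop 0] with x hx
      have := hmono2 hx
      simp only [hF0] at this
      simp; linarith
    · refine tendsto_atBot_mono' _ ?_ tendsto_id
      filter_upwards [eventually_le_atBot 0] with x hx
      have := hmono2 hx
      simp only [hF0] at this
      simp; linarith
  let e := hmono.orderIsoOfSurjective F hsurj
  let am : ℝ → ℝ := e.symm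
  have hFam : ∀ x, F (am x) = x := fun x => e.apply_symm_apply x
  have ham_c : Continuous am := e.symm.continuous
  have hinj := hmono.injective
  have ham : ∀ x, HasDerivAt am (Δ (am x)) x := fun x => by
    have := HasDerivAt.of_local_left_inverse (f := F) (g := am) (a := x) ham_c.continuousAt
      (hF (am x)) (one_div_pos.2 (hΔ _)).ne' (Eventually.of_forall hFam)
    simpa using this
  have ham_odd : ∀ x, am (-x) = - am x := fun x => hinj (by rw [hFam, hodd, hFam])
  have ham_per : ∀ x, am (x + 2 * ellK k) = am x + Real.pi := fun x =>
    hinj (by rw [hFam, hpi, hFam])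
  have hKpos : 0 < ellK k := by
    rw [← hFK, ← hF0]; exact hmono (by positivity)
  have ham_K : am (ellK k) = Real.pi / 2 := hinj (by rw [hFam, hFK])
  have ham_m : StrictMono am := e.symm.strictMono
  refine ⟨fun x => Real.sin (am x), fun x => Real.cos (am x), fun x => Δ (am x),
    hk0, hk1, hKpos, fun x => (ham x).sin, fun x => ?_, fun x => ?_, fun x => ?_, fun x => hΔ2 _,
    fun x => hΔ _, fun x => ?_, fun x => ?_, fun x => ?_, fun x => ?_, fun x => ?_, fun x => ?_,
    fun x h1 h2 => ?_, ?_⟩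
  · exact (ham x).cos.congr_deriv (by ring)
  · have h1 := (((((ham x).sin).pow 2).const_mul (k ^ 2)).const_sub 1).sqrt (hrad (am x)).ne'
    refine h1.congr_deriv ?_
    have := (hΔ (am x)).ne'
    simp only [Pi.pow_apply]
    change -(k ^ 2 * _) / (2 * Δ (am x)) = _
    field_simp
    push_cast; ring
  · exact Real.sin_sq_add_cos_sq _
  · simp [ham_odd]
  · simp [ham_odd]
  · simp [ham_odd, Δ]
  · simp [ham_per, Real.sin_add_pi]
  · simp [ham_per, Real.cos_add_pi]
  · simp [ham_per, Real.sin_add_pi, Δ]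
  · apply Real.cos_pos_of_mem_Ioo
    have := ham_m h1
    have := ham_m h2
    rw [ham_odd] at *
    rw [ham_K] at *
    constructor <;> linarith
  · simp [ham_odd, ham_K]

lemma jac_sn {k K : ℝ} {s c d sn : ℝ → ℝ} (J : Jac k K s c d) (h : IsJacobiSn k sn) : sn = s := by
  obtain ⟨h1, h2, h3, h4⟩ := h
  have d1 : ∀ x, HasDerivAt sn (deriv sn x) x := fun x =>
    ((h1.differentiable (by norm_num)) x).hasDerivAt
  have h1' : ContDiff ℝ 1 (deriv sn) := by
    have := (contDiff_succ_iff_deriv (n := 1) (f := sn)).1 (by rw [one_add_one_eq_two]; exact h1)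
    exact this.2.2
  have d2 : ∀ x, HasDerivAt (deriv sn) (-(1 + k ^ 2) * sn x + 2 * k ^ 2 * sn x ^ 3) x := fun x => by
    rw [← h4]
    exact ((h1'.differentiable (by norm_num)) x).hasDerivAt
  have cs : Continuous s := continuous_iff_continuousAt.2 fun x => (J.hs x).continuousAt
  have csn : Continuous sn := h1.continuous
  have s0 : s 0 = 0 := by have := J.s_odd 0; simp at this; linarith
  have hd0 := J.dpos 0
  have d0 : d 0 = 1 := by have := J.dd 0; rw [s0] at this; nlinarith
  have c0 : c 0 = 1 := by
    have := J.sc 0; have := J.c_pos 0 (by linarith [J.Kpos]) J.Kpos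
    rw [s0] at *; nlinarith
  funext x
  have := lin_uniq (y := fun x => sn x - s x) (z := fun x => deriv sn x - c x * d x) (x₀ := 0)
    (g := fun x => -(1 + k ^ 2) + 2 * k ^ 2 * (sn x ^ 2 + sn x * s x + s x ^ 2)) (by fun_prop)
    (fun x => (d1 x).sub (J.hs x)) (fun x => by
      refine ((d2 x).sub ((J.hc x).mul (J.hd x))).congr_deriv ?_
      have e1 := J.sc x
      have e2 := J.dd x
      linear_combination (s x) * e2 + (k ^ 2 * s x) * e1) (by simp [h2, s0]) (by simp [h3, c0, d0]) x
  linarith [this.1]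

structure Pot (q : ℝ → ℝ) (K B : ℝ) : Prop where
  cont : Continuous q
  even : ∀ x, q (-x) = q x
  per : ∀ x, q (x + 2 * K) = q x
  nonneg : ∀ x, 0 ≤ q x
  bdd : ∀ x, q x ≤ B
  Kpos : 0 < K

def IsSol (q : ℝ → ℝ) (l : ℝ) (y z : ℝ → ℝ) : Prop :=
  (∀ x, HasDerivAt y (z x) x) ∧ ∀ x, HasDerivAt z ((q x - l) * y x) x

lemma IsSol.lin {q : ℝ → ℝ} {l : ℝ} {y z y' z' : ℝ → ℝ} (h : IsSol q l y z) (h' : IsSol q l y' z')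
    (A B : ℝ) : IsSol q l (fun x => A * y x + B * y' x) (fun x => A * z x + B * z' x) :=
  ⟨fun x => ((h.1 x).const_mul A).add ((h'.1 x).const_mul B),
   fun x => (((h.2 x).const_mul A).add ((h'.2 x).const_mul B)).congr_deriv (by ring)⟩

lemma IsSol.smul {q : ℝ → ℝ} {l : ℝ} {y z : ℝ → ℝ} (h : IsSol q l y z)
    (A : ℝ) : IsSol q l (fun x => A * y x) (fun x => A * z x) :=
  ⟨fun x => ((h.1 x).const_mul A),
   fun x => (((h.2 x).const_mul A)).congr_deriv (by ring)⟩

lemma IsSol.zero_of {q : ℝ → ℝ} {l : ℝ} {y z : ℝ → ℝ} (hq : Continuous q) (h : IsSol q l y z)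
    {x₀ : ℝ} (h1 : y x₀ = 0) (h2 : z x₀ = 0) : ∀ x, y x = 0 ∧ z x = 0 :=
  lin_uniq (g := fun x => q x - l) (by fun_prop) h.1 h.2 h1 h2

lemma IsSol.uniq {q : ℝ → ℝ} {l : ℝ} {y z y' z' : ℝ → ℝ} (hq : Continuous q) (h : IsSol q l y z)
    (h' : IsSol q l y' z') {x₀ : ℝ} (h1 : y x₀ = y' x₀) (h2 : z x₀ = z' x₀) (x : ℝ) :
    y x = y' x ∧ z x = z' x := by
  have := (h.lin h' 1 (-1)).zero_of hq (x₀ := x₀) (by linarith) (by linarith) x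
  constructor <;> linarith [this.1, this.2]

lemma IsSol.reflect {q : ℝ → ℝ} {l : ℝ} {y z : ℝ → ℝ} (h : IsSol q l y z) (T : ℝ)
    (hT : ∀ x, q (T - x) = q x) : IsSol q l (fun x => y (T - x)) (fun x => - z (T - x)) := by
  have hd : ∀ x : ℝ, HasDerivAt (fun x => T - x) (-1) x := fun x =>
    (hasDerivAt_id x).const_sub T
  refine ⟨fun x => ((h.1 (T - x)).comp x (hd x)).congr_deriv (by ring), fun x => ?_⟩
  refine ((h.2 (T - x)).comp x (hd x)).neg.congr_deriv ?_
  rw [hT]; ring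

lemma IsSol.shift {q : ℝ → ℝ} {l : ℝ} {y z : ℝ → ℝ} (h : IsSol q l y z) (T : ℝ)
    (hT : ∀ x, q (x + T) = q x) : IsSol q l (fun x => y (x + T)) (fun x => z (x + T)) := by
  have hd : ∀ x : ℝ, HasDerivAt (fun x => x + T) 1 x := fun x =>
    (hasDerivAt_id x).add_const T
  refine ⟨fun x => ((h.1 (x + T)).comp x (hd x)).congr_deriv (by ring), fun x => ?_⟩
  refine ((h.2 (x + T)).comp x (hd x)).congr_deriv ?_
  rw [hT]; ring

lemma IsSol.wronsk {q : ℝ → ℝ} {l : ℝ} {y z y' z' : ℝ → ℝ} (h : IsSol q l y z)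
    (h' : IsSol q l y' z') (x x₀ : ℝ) : y x * z' x - z x * y' x = y x₀ * z' x₀ - z x₀ * y' x₀ := by
  have hd : ∀ x, HasDerivAt (fun x => y x * z' x - z x * y' x) 0 x := fun x =>
    (((h.1 x).mul (h'.2 x)).sub ((h.2 x).mul (h'.1 x))).congr_deriv (by ring)
  exact is_const_of_deriv_eq_zero (fun x => (hd x).differentiableAt) (fun x => (hd x).deriv) x x₀

/-- the solution with Neumann data at the origin -/
def NSol (q : ℝ → ℝ) (l : ℝ) (y z : ℝ → ℝ) : Prop := IsSol q l y z ∧ y 0 = 1 ∧ z 0 = 0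
/-- the solution with Dirichlet data at the origin -/
def DSol (q : ℝ → ℝ) (l : ℝ) (y z : ℝ → ℝ) : Prop := IsSol q l y z ∧ y 0 = 0 ∧ z 0 = 1

lemma Pot.refl2 {q : ℝ → ℝ} {K B : ℝ} (P : Pot q K B) (x : ℝ) : q (2 * K - x) = q x := by
  rw [show 2 * K - x = -x + 2 * K by ring, P.per, P.even]

lemma NSol.even {q : ℝ → ℝ} {K B l : ℝ} (P : Pot q K B) {y z : ℝ → ℝ} (h : NSol q l y z) (x : ℝ) :
    y (-x) = y x ∧ z (-x) = - z x := by
  have := (h.1.reflect 0 (fun x => by rw [zero_sub, P.even])).uniq P.cont h.1 (x₀ := 0)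
    (by simp) (by simp [h.2.2]) x
  simp only [zero_sub] at this
  exact ⟨this.1, by linarith [this.2]⟩

lemma DSol.odd {q : ℝ → ℝ} {K B l : ℝ} (P : Pot q K B) {y z : ℝ → ℝ} (h : DSol q l y z) (x : ℝ) :
    y (-x) = - y x ∧ z (-x) = z x := by
  have := (h.1.reflect 0 (fun x => by rw [zero_sub, P.even])).uniq P.cont (h.1.smul (-1)) (x₀ := 0)
    (by simp [h.2.1]) (by simp) x
  simp only [zero_sub] at this
  exact ⟨by linarith [this.1], by linarith [this.2]⟩

lemma refl_plus {q : ℝ → ℝ} {K B l : ℝ} (P : Pot q K B) {y z : ℝ → ℝ} (h : IsSol q l y z)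
    (hz : z K = 0) (x : ℝ) : y (2 * K - x) = y x := by
  have := (h.reflect (2 * K) P.refl2).uniq P.cont h (x₀ := K)
    (by congr 1; ring) (by rw [show 2 * K - K = K by ring]; simp [hz]) x
  exact this.1

lemma refl_minus {q : ℝ → ℝ} {K B l : ℝ} (P : Pot q K B) {y z : ℝ → ℝ} (h : IsSol q l y z)
    (hz : y K = 0) (x : ℝ) : y (2 * K - x) = - y x := by
  have := (h.reflect (2 * K) P.refl2).uniq P.cont (h.smul (-1)) (x₀ := K)
    (by rw [show 2 * K - K = K by ring]; simp [hz]) (by rw [show 2 * K - K = K by ring]; simp) x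
  linarith [this.1]

lemma pr_uniq {Q θ₁ θ₂ : ℝ → ℝ} (hQ : Continuous Q) (h₁ : IsPr Q θ₁) (h₂ : IsPr Q θ₂)
    (h0 : θ₁ 0 = θ₂ 0) (x : ℝ) : θ₁ x = θ₂ x := by
  obtain ⟨E, hE, hE0, hd⟩ := pr_diff hQ h₁ h₂
  have hc := is_const_of_deriv_eq_zero (f := fun x => (θ₂ x - θ₁ x) * E x)
    (fun x => (hd x).differentiableAt) (fun x => by rw [(hd x).deriv]; simp) x 0
  simp only [h0, sub_self, zero_mul] at hc
  have := (mul_eq_zero.1 hc).resolve_right (hE x).ne'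
  linarith

lemma IsPr.neg {Q θ : ℝ → ℝ} (h : IsPr Q θ) (hQ : ∀ x, Q (-x) = Q x) :
    IsPr Q (fun x => - θ (-x)) := by
  intro x
  refine (((h (-x)).comp x (hasDerivAt_neg x)).neg).congr_deriv ?_
  simp [prF, hQ]

lemma zeros_of_angle {θ : ℝ → ℝ} (hθ : Continuous θ) {K : ℝ} (hK : 0 < K) {n : ℕ}
    (h : θ K = θ (-K) + n * Real.pi) :
    ∃ S : Finset ℝ, S.card = n ∧ ∀ x ∈ S, -K ≤ x ∧ x < K ∧ Real.sin (θ x) = 0 := by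
  have hpi := Real.pi_pos
  have hex : ∀ i : Fin n, ∃ x, (-K ≤ x ∧ x < K) ∧
      θ x = ((⌈θ (-K) / Real.pi⌉ + (i : ℕ) : ℤ) : ℝ) * Real.pi := by
    intro i
    have h1 := Int.le_ceil (θ (-K) / Real.pi)
    have h2 := Int.ceil_lt_add_one (θ (-K) / Real.pi)
    have h3 : θ (-K) / Real.pi * Real.pi = θ (-K) := by field_simp
    have hi : ((i : ℕ) : ℝ) + 1 ≤ n := by exact_mod_cast i.2
    have := intermediate_value_Ico (f := θ) (a := -K) (b := K) (by linarith) hθ.continuousOn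
      (show ((⌈θ (-K) / Real.pi⌉ + (i : ℕ) : ℤ) : ℝ) * Real.pi ∈ Ico (θ (-K)) (θ K) by
        have h4 : (0:ℝ) ≤ ((i : ℕ) : ℝ) := Nat.cast_nonneg _
        push_cast
        rw [h]
        constructor
        · nlinarith
        · nlinarith)
    obtain ⟨x, hx, hx2⟩ := this
    exact ⟨x, hx, hx2⟩
  choose x hx hx2 using hex
  have hinj : Function.Injective x := by
    intro i j hij
    have := hx2 i
    rw [hij, hx2 j] at this
    have := mul_right_cancel₀ hpi.ne' this
    have := Int.cast_injective this
    exact Fin.ext (by omega)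
  refine ⟨Finset.univ.image x, by simp [Finset.card_image_of_injective _ hinj], fun y hy => ?_⟩
  obtain ⟨i, -, rfl⟩ := Finset.mem_image.1 hy
  exact ⟨(hx i).1, (hx i).2, by rw [hx2 i]; exact Real.sin_int_mul_pi _⟩

structure Osc (q : ℝ → ℝ) (K : ℝ) (a b : ℕ → ℝ) : Prop where
  aa : ∀ n, a n < a (n + 1)
  ab : ∀ n, a n < b (n + 1)
  ba : ∀ n, 1 ≤ n → b n < a (n + 1)
  bb : ∀ n, 1 ≤ n → b n < b (n + 1)
  tend : Tendsto a atTop atTop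
  exN : ∀ l, ∃ y z, NSol q l y z
  exD : ∀ l, ∃ y z, DSol q l y z
  perN : ∀ n y z, NSol q (a n) y z → ∀ x, y (x + 2 * K) = (-1) ^ n * y x
  perD : ∀ n y z, 1 ≤ n → DSol q (b n) y z → ∀ x, y (x + 2 * K) = (-1) ^ n * y x
  ofN : ∀ l y z σ, NSol q l y z → (σ = 1 ∨ σ = -1) → (∀ x, y (x + 2 * K) = σ * y x) →
    ∃ n, a n = l ∧ σ = (-1) ^ n
  ofD : ∀ l y z σ, DSol q l y z → (σ = 1 ∨ σ = -1) → (∀ x, y (x + 2 * K) = σ * y x) →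
    ∃ n, 1 ≤ n ∧ b n = l ∧ σ = (-1) ^ n
  zeroN : ∀ n y z, NSol q (a n) y z → ∃ S : Finset ℝ, S.card = n ∧
    ∀ x ∈ S, -K ≤ x ∧ x < K ∧ y x = 0
  zeroD : ∀ n y z, 1 ≤ n → DSol q (b n) y z → ∃ S : Finset ℝ, S.card = n ∧
    ∀ x ∈ S, -K ≤ x ∧ x < K ∧ y x = 0

lemma floq_deriv {q : ℝ → ℝ} {l : ℝ} {y z : ℝ → ℝ} (h : IsSol q l y z) {T σ : ℝ}
    (hp : ∀ x, y (x + T) = σ * y x) (x : ℝ) : z (x + T) = σ * z x := by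
  have h1 : HasDerivAt (fun x => y (x + T)) (z (x + T)) x :=
    ((h.1 (x + T)).comp x ((hasDerivAt_id x).add_const T)).congr_deriv (by ring)
  have h2 : HasDerivAt (fun x => y (x + T)) (σ * z x) x := by
    rw [funext hp]; exact (h.1 x).const_mul σ
  exact h1.unique h2

lemma cos_zero_pos {t : ℝ} (h : Real.cos t = 0) (ht : 0 < t) :
    ∃ j : ℕ, t = Real.pi / 2 + j * Real.pi := by
  obtain ⟨j, hj⟩ := Real.cos_eq_zero_iff.1 h
  have hpi := Real.pi_pos
  have : -1 < j := by
    by_contra hcon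
    push Not at hcon
    have : (j : ℝ) ≤ -1 := by exact_mod_cast hcon
    nlinarith
  lift j to ℕ using (by omega)
  exact ⟨j, by rw [hj]; push_cast; ring⟩

lemma sin_zero_pos {t : ℝ} (h : Real.sin t = 0) (ht : 0 < t) :
    ∃ j : ℕ, 1 ≤ j ∧ t = j * Real.pi := by
  obtain ⟨j, hj⟩ := Real.sin_eq_zero_iff.1 h
  have hpi := Real.pi_pos
  have : 0 < j := by
    by_contra hcon
    push Not at hcon
    have : (j : ℝ) ≤ 0 := by exact_mod_cast hcon
    nlinarith
  lift j to ℕ using (by omega)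
  exact ⟨j, by omega, by rw [← hj]; push_cast; ring⟩

lemma osc_exists {q : ℝ → ℝ} {K B : ℝ} (P : Pot q K B) : ∃ a b, Osc q K a b := by
  have hpi := Real.pi_pos
  have hqc := P.cont
  have hB0 : 0 ≤ B := (P.nonneg 0).trans (P.bdd 0)
  have hB : ∀ x, |q x| ≤ B := fun x => by rw [abs_of_nonneg (P.nonneg x)]; exact P.bdd x
  have hQc : ∀ l : ℝ, Continuous (fun x => l - q x) := fun l => by fun_prop
  have hBl : ∀ l : ℝ, ∀ y, |l - q y| ≤ |l| + B := fun l y => (abs_sub _ _).trans (by linarith [hB y])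
  have hex : ∀ θ₀ l : ℝ, ∃ θ : ℝ → ℝ, θ 0 = θ₀ ∧ IsPr (fun x => l - q x) θ := fun θ₀ l =>
    pruefer_exists (hQc l) (by positivity) (hBl l) θ₀
  choose θD D0 DP using hex 0
  choose θN N0 NP using hex (Real.pi / 2)
  -- comparison of angles
  have hD_pos : ∀ l, ∀ x, 0 < x → 0 < θD l x := fun l x hx =>
    pr_gt_const (hQc l) (DP l) 0 (fun x => by simp [prF]) (D0 l).ge hx
  have hDN : ∀ l x, θD l x < θN l x := fun l x =>
    pr_lt (hQc l) (DP l) (NP l) (by rw [D0, N0]; positivity) x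
  have hND : ∀ l x, θN l x < θD l x + Real.pi := fun l x =>
    pr_lt (hQc l) (NP l) (DP l).add_pi (by rw [D0, N0]; linarith) x
  have hDmono : StrictMono (fun l => θD l K) := fun l l' h =>
    pr_le (hQc l') (DP l) (DP l') (by rw [D0, D0]) (fun x => by linarith) P.Kpos
  have hNmono : StrictMono (fun l => θN l K) := fun l l' h =>
    pr_le (hQc l') (NP l) (NP l') (by rw [N0, N0]) (fun x => by linarith) P.Kpos
  have hDcont : Continuous (fun l => θD l K) := pr_cont hB θD DP D0 P.Kpos.le
  have hNcont : Continuous (fun l => θN l K) := pr_cont hB θN NP N0 P.Kpos.le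
  have hNneg : θN (-1) K < Real.pi / 2 := pr_lt_const (hQc (-1)) (NP (-1)) _ (fun x => by
    simp [prF]; linarith [P.nonneg x]) (N0 _).le P.Kpos
  have hlarge : ∀ t : ℝ, ∃ l, -1 < l ∧ t ≤ θD l K := by
    intro t
    obtain ⟨N, hN⟩ := exists_nat_gt (max 0 ((t + Real.pi / 2) / K))
    have hN0 : (0:ℝ) < N := (le_max_left _ _).trans_lt hN
    have hN1 : (t + Real.pi / 2) / K < N := (le_max_right _ _).trans_lt hN
    rw [div_lt_iff₀ P.Kpos] at hN1
    refine ⟨(N:ℝ) ^ 2 + B, by nlinarith [sq_nonneg (N:ℝ)], ?_⟩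
    have := pr_growth (DP ((N:ℝ) ^ 2 + B)) (D0 _) hN0 (fun x => by linarith [P.bdd x]) P.Kpos.le
    linarith
  have hexa : ∀ n : ℕ, ∃ l, θN l K = Real.pi / 2 + n * (Real.pi / 2) := by
    intro n
    obtain ⟨l, hl, hl2⟩ := hlarge (Real.pi / 2 + n * (Real.pi / 2))
    have := intermediate_value_Icc (f := fun l => θN l K) hl.le hNcont.continuousOn
      (show Real.pi / 2 + n * (Real.pi / 2) ∈ Icc _ _ from ⟨by
        have : (0:ℝ) ≤ n * (Real.pi / 2) := by positivity
        linarith, by linarith [hDN l K]⟩)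
    obtain ⟨x, -, hx⟩ := this
    exact ⟨x, hx⟩
  have hexb : ∀ n : ℕ, ∃ l, 1 ≤ n → θD l K = n * (Real.pi / 2) := by
    intro n
    by_cases hn : 1 ≤ n
    · obtain ⟨l, hl, hl2⟩ := hlarge (n * (Real.pi / 2))
      have := intermediate_value_Icc (f := fun l => θD l K) hl.le hDcont.continuousOn
        (show n * (Real.pi / 2) ∈ Icc _ _ from ⟨by
          have : (1:ℝ) ≤ n := by exact_mod_cast hn
          have := hDN (-1) K
          nlinarith, by linarith⟩)
      obtain ⟨x, -, hx⟩ := this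
      exact ⟨x, fun _ => hx⟩
    · exact ⟨0, fun h => absurd h hn⟩
  choose a ha using hexa
  choose b hb using hexb
  -- linear solutions
  have repN : ∀ l y z, NSol q l y z → ∃ r : ℝ → ℝ, (∀ x, 0 < r x) ∧
      ∀ x, y x = r x * Real.sin (θN l x) ∧ z x = r x * Real.cos (θN l x) := by
    intro l y z h
    obtain ⟨r, hr, r0, h1, h2⟩ := pr_linear (hQc l) (NP l)
    refine ⟨r, hr, h.1.uniq hqc ⟨h1, fun x => (h2 x).congr_deriv (by ring)⟩ (x₀ := 0) ?_ ?_⟩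
    · simp [h.2.1, r0, N0]
    · simp [h.2.2, r0, N0]
  have repD : ∀ l y z, DSol q l y z → ∃ r : ℝ → ℝ, (∀ x, 0 < r x) ∧
      ∀ x, y x = r x * Real.sin (θD l x) ∧ z x = r x * Real.cos (θD l x) := by
    intro l y z h
    obtain ⟨r, hr, r0, h1, h2⟩ := pr_linear (hQc l) (DP l)
    refine ⟨r, hr, h.1.uniq hqc ⟨h1, fun x => (h2 x).congr_deriv (by ring)⟩ (x₀ := 0) ?_ ?_⟩
    · simp [h.2.1, r0, D0]
    · simp [h.2.2, r0, D0]
  have haa : ∀ n, a n < a (n + 1) := fun n => hNmono.lt_iff_lt.1 (by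
      rw [ha, ha]; push_cast; nlinarith)
  refine ⟨a, b, haa, ?_, ?_, ?_, ?_, ?_, ?_, ?_, ?_, ?_, ?_, ?_, ?_⟩
  · intro n
    refine hDmono.lt_iff_lt.1 ?_
    have h1 := hDN (a n) K
    rw [ha] at h1
    rw [hb _ (by omega)]; push_cast; linarith
  · intro n hn
    refine hNmono.lt_iff_lt.1 ?_
    have h1 := hND (b n) K
    rw [hb n hn] at h1
    rw [ha]; push_cast; linarith
  · intro n hn
    refine hDmono.lt_iff_lt.1 ?_
    rw [hb n hn, hb _ (by omega)]; push_cast; linarith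
  · refine tendsto_atTop_atTop_of_monotone (strictMono_nat_of_lt_succ haa).monotone (fun L => ?_)
    obtain ⟨n, hn⟩ := exists_nat_gt (θN L K / (Real.pi / 2))
    refine ⟨n, hNmono.le_iff_le.1 ?_⟩
    rw [div_lt_iff₀ (by positivity)] at hn
    rw [ha]; linarith
  · intro l
    obtain ⟨r, hr, r0, h1, h2⟩ := pr_linear (hQc l) (NP l)
    exact ⟨_, _, ⟨h1, fun x => (h2 x).congr_deriv (by ring)⟩, by simp [r0, N0], by simp [N0]⟩
  · intro l
    obtain ⟨r, hr, r0, h1, h2⟩ := pr_linear (hQc l) (DP l)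
    exact ⟨_, _, ⟨h1, fun x => (h2 x).congr_deriv (by ring)⟩, by simp [D0], by simp [r0, D0]⟩
  · intro n y z h x
    obtain ⟨r, hr, hyz⟩ := repN _ _ _ h
    have hev := fun x => (h.even P x).1
    rcases Nat.even_or_odd' n with ⟨j, rfl | rfl⟩
    · have : z K = 0 := by
        rw [(hyz K).2, ha, show Real.pi / 2 + ((2 * j : ℕ) : ℝ) * (Real.pi / 2)
          = Real.pi / 2 + j * Real.pi by push_cast; ring, Real.cos_add_nat_mul_pi]
        simp
      have := refl_plus P h.1 this (-x)
      rw [show x + 2 * K = 2 * K - -x by ring, this, hev]; simp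
    · have : y K = 0 := by
        rw [(hyz K).1, ha, show Real.pi / 2 + ((2 * j + 1 : ℕ) : ℝ) * (Real.pi / 2)
          = Real.pi + j * Real.pi by push_cast; ring, Real.sin_add_nat_mul_pi]
        simp
      have := refl_minus P h.1 this (-x)
      rw [show x + 2 * K = 2 * K - -x by ring, this, hev]; simp [pow_succ]
  · intro n y z hn h x
    obtain ⟨r, hr, hyz⟩ := repD _ _ _ h
    have hev := fun x => (h.odd P x).1
    rcases Nat.even_or_odd' n with ⟨j, rfl | rfl⟩
    · have : y K = 0 := by
        rw [(hyz K).1, hb _ hn, show ((2 * j : ℕ) : ℝ) * (Real.pi / 2)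
          = j * Real.pi by push_cast; ring, Real.sin_nat_mul_pi]
        simp
      have := refl_minus P h.1 this (-x)
      rw [show x + 2 * K = 2 * K - -x by ring, this, hev]; simp
    · have : z K = 0 := by
        rw [(hyz K).2, hb _ hn, show ((2 * j + 1 : ℕ) : ℝ) * (Real.pi / 2)
          = Real.pi / 2 + j * Real.pi by push_cast; ring, Real.cos_add_nat_mul_pi]
        simp
      have := refl_plus P h.1 this (-x)
      rw [show x + 2 * K = 2 * K - -x by ring, this, hev]; simp [pow_succ]
  · intro l y z σ h hσ hp
    obtain ⟨r, hr, hyz⟩ := repN _ _ _ h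
    have h1 := hp (-K)
    have h2 := floq_deriv h.1 hp (-K)
    rw [show -K + 2 * K = K by ring] at h1 h2
    rw [(h.even P K).1] at h1
    rw [(h.even P K).2] at h2
    have hpos : 0 < θN l K := (hD_pos l K P.Kpos).trans (hDN l K)
    rcases hσ with rfl | rfl
    · have : z K = 0 := by linarith
      rw [(hyz K).2] at this
      obtain ⟨j, hj⟩ := cos_zero_pos ((mul_eq_zero.1 this).resolve_left (hr K).ne') hpos
      refine ⟨2 * j, hNmono.injective ?_, by simp⟩
      rw [ha, hj]; push_cast; ring
    · have : y K = 0 := by linarith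
      rw [(hyz K).1] at this
      obtain ⟨j, hj1, hj⟩ := sin_zero_pos ((mul_eq_zero.1 this).resolve_left (hr K).ne') hpos
      obtain ⟨i, rfl⟩ := Nat.exists_eq_add_of_le' hj1
      refine ⟨2 * i + 1, hNmono.injective ?_, by simp [pow_succ]⟩
      rw [ha, hj]; push_cast; ring
  · intro l y z σ h hσ hp
    obtain ⟨r, hr, hyz⟩ := repD _ _ _ h
    have h1 := hp (-K)
    have h2 := floq_deriv h.1 hp (-K)
    rw [show -K + 2 * K = K by ring] at h1 h2
    rw [(h.odd P K).1] at h1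
    rw [(h.odd P K).2] at h2
    have hpos : 0 < θD l K := (hD_pos l K P.Kpos)
    rcases hσ with rfl | rfl
    · have : y K = 0 := by linarith
      rw [(hyz K).1] at this
      obtain ⟨j, hj1, hj⟩ := sin_zero_pos ((mul_eq_zero.1 this).resolve_left (hr K).ne') hpos
      refine ⟨2 * j, by omega, hDmono.injective ?_, by simp⟩
      rw [hb _ (by omega), hj]; push_cast; ring
    · have : z K = 0 := by linarith
      rw [(hyz K).2] at this
      obtain ⟨j, hj⟩ := cos_zero_pos ((mul_eq_zero.1 this).resolve_left (hr K).ne') hpos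
      refine ⟨2 * j + 1, by omega, hDmono.injective ?_, by simp [pow_succ]⟩
      rw [hb _ (by omega), hj]; push_cast; ring
  · intro n y z h
    obtain ⟨r, hr, hyz⟩ := repN _ _ _ h
    have hneg : θN (a n) (-K) = Real.pi - θN (a n) K := by
      have := pr_uniq (hQc (a n)) ((NP (a n)).neg (fun x => by rw [P.even])).add_pi (NP (a n))
        (by simp [N0]; ring) (-K)
      simp only [neg_neg] at this
      linarith
    obtain ⟨S, hS, hS2⟩ := zeros_of_angle (NP (a n)).cont P.Kpos (n := n) (by
      rw [hneg, ha]; ring)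
    exact ⟨S, hS, fun x hx => ⟨(hS2 x hx).1, (hS2 x hx).2.1, by
      rw [(hyz x).1, (hS2 x hx).2.2, mul_zero]⟩⟩
  · intro n y z hn h
    obtain ⟨r, hr, hyz⟩ := repD _ _ _ h
    have hneg : θD (b n) (-K) = - θD (b n) K := by
      have := pr_uniq (hQc (b n)) ((DP (b n)).neg (fun x => by rw [P.even])) (DP (b n))
        (by simp [D0]) (-K)
      simp only [neg_neg] at this
      linarith
    obtain ⟨S, hS, hS2⟩ := zeros_of_angle (DP (b n)).cont P.Kpos (n := n) (by
      rw [hneg, hb n hn]; ring)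
    exact ⟨S, hS, fun x hx => ⟨(hS2 x hx).1, (hS2 x hx).2.1, by
      rw [(hyz x).1, (hS2 x hx).2.2, mul_zero]⟩⟩

lemma Jac.t_deriv {k K : ℝ} {s c d : ℝ → ℝ} (J : Jac k K s c d) {x : ℝ} (h : c x ≠ 0) :
    HasDerivAt (fun x => s x / c x) (d x / c x ^ 2) x := by
  refine ((J.hs x).div (J.hc x) h).congr_deriv ?_
  have := J.sc x
  field_simp
  linear_combination d x * this

lemma Jac.t_inj {k K : ℝ} {s c d : ℝ → ℝ} (J : Jac k K s c d) :
    Set.InjOn (fun x => s x / c x) (Ioo (-K) K) := by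
  refine StrictMonoOn.injOn (strictMonoOn_of_deriv_pos (convex_Ioo _ _) ?_ ?_)
  · intro x hx
    exact (J.t_deriv (J.c_pos x hx.1 hx.2).ne').continuousAt.continuousWithinAt
  · intro x hx
    rw [interior_Ioo] at hx
    have := J.c_pos x hx.1 hx.2
    rw [(J.t_deriv this.ne').deriv]
    have := J.dpos x
    positivity

lemma Jac.poly_zero {k K : ℝ} {s c d : ℝ → ℝ} (J : Jac k K s c d) (p : Polynomial ℝ)
    (h : ∀ x ∈ Ioo (-K) K, p.eval (s x / c x) = 0) : p = 0 := by
  refine Polynomial.eq_zero_of_infinite_isRoot p ?_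
  refine Set.Infinite.mono (s := (fun x => s x / c x) '' Ioo (-K) K) ?_ ?_
  · rintro _ ⟨x, hx, rfl⟩
    exact h x hx
  · exact (Ioo_infinite (by linarith [J.Kpos])).image J.t_inj

lemma double_roots {p : Polynomial ℝ} (hp : p ≠ 0) (T : Finset ℝ)
    (h : ∀ t ∈ T, p.eval t = 0 ∧ p.derivative.eval t = 0) : 2 * T.card ≤ p.natDegree := by
  classical
  refine le_trans ?_ p.card_roots'
  have : (2 • T.val) ≤ p.roots := by
    rw [Multiset.le_iff_count]
    intro t
    rw [Multiset.count_nsmul, Polynomial.count_roots]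
    by_cases ht : t ∈ T
    · have := (Polynomial.one_lt_rootMultiplicity_iff_isRoot hp).2 (h t ht)
      have h2 := Multiset.nodup_iff_count_le_one.1 T.nodup t
      nlinarith
    · rw [Multiset.count_eq_zero_of_notMem (by simpa using ht)]; simp
  have := Multiset.card_le_card this
  simpa using this

lemma lemmaZ {k K : ℝ} {s c d : ℝ → ℝ} (J : Jac k K s c d) {y z : ℝ → ℝ}
    (hy : ∀ x, HasDerivAt y (z x) x) {n m : ℕ} {S : Finset ℝ} (hS : S.card = n)
    (hS2 : ∀ x ∈ S, -K ≤ x ∧ x < K ∧ y x = 0) {p : Polynomial ℝ} (hp : p ≠ 0)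
    (hdeg : p.natDegree ≤ 2 * m) (A : ℝ)
    (h : ∀ x ∈ Ioo (-K) K, A * y x ^ 2 = c x ^ (2 * m) * p.eval (s x / c x)) : n ≤ m := by
  classical
  have hroot : ∀ x ∈ Ioo (-K) K, y x = 0 → p.eval (s x / c x) = 0 ∧
      p.derivative.eval (s x / c x) = 0 := by
    intro x hx hyx
    have hc := J.c_pos x hx.1 hx.2
    have h1 : p.eval (s x / c x) = 0 := by
      have := h x hx
      rw [hyx] at this
      have h2 : c x ^ (2 * m) * p.eval (s x / c x) = 0 := by rw [← this]; ring
      exact (mul_eq_zero.1 h2).resolve_left (by positivity)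
    refine ⟨h1, ?_⟩
    have d1 : HasDerivAt (fun x => A * y x ^ 2) 0 x := by
      refine (((hy x).pow 2).const_mul A).congr_deriv ?_
      rw [hyx]; simp
    have d2 := ((J.hc x).pow (2 * m)).mul ((p.hasDerivAt (s x / c x)).comp x (J.t_deriv hc.ne'))
    have heq : (fun x => A * y x ^ 2) =ᶠ[nhds x]
        (c ^ (2 * m) * ((fun x => p.eval x) ∘ fun x => s x / c x)) := by
      filter_upwards [Ioo_mem_nhds hx.1 hx.2] with x' hx'
      exact h x' hx'
    have := d1.unique (d2.congr_of_eventuallyEq heq)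
    simp only [Function.comp, h1, Pi.pow_apply, mul_zero, zero_add] at this
    have hd := J.dpos x
    have h3 : p.derivative.eval (s x / c x) * (c x ^ (2 * m) * (d x / c x ^ 2)) = 0 := by
      rw [this]; ring
    exact (mul_eq_zero.1 h3).resolve_right (by positivity)
  let T := (S.erase (-K)).image (fun x => s x / c x)
  have hmem : ∀ x ∈ S.erase (-K), x ∈ Ioo (-K) K := fun x hx => by
    rw [Finset.mem_erase] at hx
    have := hS2 x hx.2
    exact ⟨lt_of_le_of_ne this.1 hx.1.symm, this.2.1⟩
  have hT : T.card = (S.erase (-K)).card :=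
    Finset.card_image_of_injOn (fun x hx x' hx' => J.t_inj (hmem x hx) (hmem x' hx'))
  have hT2 := double_roots hp T (fun t ht => by
    obtain ⟨x, hx, rfl⟩ := Finset.mem_image.1 ht
    exact hroot x (hmem x hx) (hS2 x (Finset.mem_of_mem_erase hx)).2.2)
  by_cases hK : -K ∈ S
  · have hcard := Finset.card_erase_add_one hK
    have hyK := (hS2 _ hK).2.2
    -- top coefficient vanishes
    let g : ℝ → ℝ := fun x => ∑ j ∈ Finset.range (2 * m + 1), p.coeff j * (c x ^ (2 * m - j) * s x ^ j)
    have hcc : Continuous c := continuous_iff_continuousAt.2 fun x => (J.hc x).continuousAt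
    have hsc : Continuous s := continuous_iff_continuousAt.2 fun x => (J.hs x).continuousAt
    have hyc : Continuous y := continuous_iff_continuousAt.2 fun x => (hy x).continuousAt
    have hg : Continuous g := by fun_prop
    have heq : EqOn (fun x => A * y x ^ 2) g (Ioo (-K) K) := by
      intro x hx
      have hc := (J.c_pos x hx.1 hx.2).ne'
      simp only [g]
      rw [h x hx, Polynomial.eval_eq_sum_range' (n := 2 * m + 1) (by omega), Finset.mul_sum]
      refine Finset.sum_congr rfl (fun j hj => ?_)
      rw [Finset.mem_range] at hj
      rw [show c x ^ (2 * m) = c x ^ (2 * m - j) * c x ^ j by rw [← pow_add]; congr 1; omega]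
      rw [div_pow]
      field_simp
    have heq2 := heq.closure (by fun_prop) hg
    rw [closure_Ioo (by linarith [J.Kpos])] at heq2
    have h4 := heq2 (left_mem_Icc.2 (by linarith [J.Kpos]))
    have hs1 : s (-K) ^ 2 = 1 := by have := J.sc (-K); rw [J.c_K] at this; linarith
    simp only [g, J.c_K, hyK] at h4
    rw [Finset.sum_range_succ, Finset.sum_eq_zero (fun j hj => by
      rw [Finset.mem_range] at hj
      rw [zero_pow (by omega)]; ring), pow_mul, hs1] at h4
    simp at h4
    have hlt : p.natDegree ≠ 2 * m := fun e => hp (Polynomial.leadingCoeff_eq_zero.1 (by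
      rw [Polynomial.leadingCoeff, e]; exact h4.symm))
    omega
  · rw [Finset.erase_eq_of_notMem hK] at hT
    omega

section
open Polynomial

lemma Osc.a_mono {q : ℝ → ℝ} {K : ℝ} {a b : ℕ → ℝ} (O : Osc q K a b) : StrictMono a :=
  strictMono_nat_of_lt_succ O.aa

lemma Osc.b_mono {q : ℝ → ℝ} {K : ℝ} {a b : ℕ → ℝ} (O : Osc q K a b) {i j : ℕ} (hi : 1 ≤ i)
    (hij : i ≤ j) : b i ≤ b j := by
  have : StrictMono (fun n => b (n + 1)) := strictMono_nat_of_lt_succ fun n => O.bb _ (by omega)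
  obtain ⟨i, rfl⟩ := Nat.exists_eq_add_of_le' hi
  obtain ⟨j, rfl⟩ := Nat.exists_eq_add_of_le' (hi.trans hij)
  exact this.monotone (by omega : i ≤ j)

lemma Osc.a_eq_b {q : ℝ → ℝ} {K : ℝ} {a b : ℕ → ℝ} (O : Osc q K a b) {i j : ℕ} (hj : 1 ≤ j)
    (h : a i = b j) : i = j := by
  rcases lt_trichotomy i j with hlt | heq | hgt
  · have h1 := O.ab i
    have h2 := O.b_mono (by omega : 1 ≤ i + 1) hlt
    linarith
  · exact heq
  · have h1 := O.ba j hj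
    have h2 := O.a_mono.monotone (by omega : j + 1 ≤ i)
    linarith

lemma jac_pot {k K : ℝ} {s c d : ℝ → ℝ} (J : Jac k K s c d) (m : ℕ) :
    Pot (lamePot m k s) K ((m * (m + 1) : ℝ) * k ^ 2) := by
  have hsc : Continuous s := continuous_iff_continuousAt.2 fun x => (J.hs x).continuousAt
  refine ⟨by unfold lamePot; fun_prop, fun x => ?_, fun x => ?_, fun x => ?_, fun x => ?_, J.Kpos⟩
  · simp [lamePot, J.s_odd]
  · simp [lamePot, J.s_per]
  · unfold lamePot; positivity
  · unfold lamePot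
    have := J.sc x
    have h1 : s x ^ 2 ≤ 1 := by nlinarith [sq_nonneg (c x)]
    have h2 : (0:ℝ) ≤ (m * (m + 1) : ℝ) * k ^ 2 := by positivity
    nlinarith

/-- The third order operator in algebraic form. -/
def lameT (A k l : ℝ) : ℝ[X] →ₗ[ℝ] ℝ[X] where
  toFun P := (4 * X * (1 - X) * (1 - C (k ^ 2) * X)) * derivative (derivative (derivative P))
    + C (3 / 2) * (4 - C (8 * (1 + k ^ 2)) * X + C (12 * k ^ 2) * X ^ 2) * derivative (derivative P)
    + C (1 / 2) * (C (-8 * (1 + k ^ 2)) + C (24 * k ^ 2) * X) * derivative P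
    - 4 * (C A * X - C l) * derivative P - C (2 * A) * P
  map_add' P Q := by simp only [map_add]; ring
  map_smul' r P := by simp only [smul_eq_C_mul, derivative_C_mul, RingHom.id_apply]; ring

lemma lameT_X_pow (A k l : ℝ) (j : ℕ) : lameT A k l ((X : ℝ[X]) ^ j) =
    C (2 * (2 * (j : ℝ) + 1) * (k ^ 2 * ((j : ℝ) * (j + 1)) - A)) * (X : ℝ[X]) ^ j
    + C (4 * (j : ℝ) * (l - (1 + k ^ 2) * (j : ℝ) ^ 2)) * (X : ℝ[X]) ^ (j - 1)
    + C (2 * (j : ℝ) * (j - 1) * (2 * j - 1)) * (X : ℝ[X]) ^ (j - 2) := by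
  refine Polynomial.funext fun x => ?_
  simp only [lameT, LinearMap.coe_mk, AddHom.coe_mk, derivative_X_pow, derivative_C_mul, eval_add,
    eval_sub, eval_mul, eval_C, eval_X, eval_pow, eval_one, eval_ofNat]
  rcases j with _ | _ | _ | j
  · norm_num
  · norm_num; ring
  · norm_num; ring
  · simp only [Nat.add_one_sub_one, show j + 1 + 1 + 1 - 2 = j + 1 from rfl]
    push_cast
    ring

lemma lame_poly_exists (m : ℕ) (k l : ℝ) :
    ∃ P : ℝ[X], P ≠ 0 ∧ P.natDegree ≤ m ∧ lameT ((m * (m + 1) : ℝ) * k ^ 2) k l P = 0 := by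
  set T := lameT ((m * (m + 1) : ℝ) * k ^ 2) k l with hT
  have hmap : ∀ P ∈ degreeLT ℝ (m + 1), T P ∈ degreeLT ℝ m := by
    intro P hP
    rw [degreeLT_eq_span_X_pow] at hP
    have hle : Submodule.span ℝ ((Finset.image (fun n => (X : ℝ[X]) ^ n) (Finset.range (m + 1)) : Finset ℝ[X]) : Set ℝ[X])
        ≤ (degreeLT ℝ m).comap T := by
      rw [Submodule.span_le]
      intro Q hQ
      simp only [Finset.coe_image, Set.mem_image, Finset.coe_range, Set.mem_Iio] at hQ
      obtain ⟨j, hj, rfl⟩ := hQ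
      change T (X ^ j) ∈ degreeLT ℝ m
      rw [hT, lameT_X_pow]
      have hmon : ∀ (α : ℝ) (i : ℕ), (α = 0 ∨ i < m) → C α * X ^ i ∈ degreeLT ℝ m := by
        intro α i h
        rcases h with rfl | h
        · simp
        · rw [mem_degreeLT]
          exact (degree_C_mul_X_pow_le i α).trans_lt (by exact_mod_cast h)
      refine Submodule.add_mem _ (Submodule.add_mem _ (hmon _ _ ?_) (hmon _ _ ?_)) (hmon _ _ ?_)
      · rcases eq_or_lt_of_le (Nat.lt_succ_iff.1 hj) with rfl | h
        · left; ring
        · right; exact h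
      · rcases j with _ | j
        · left; simp
        · right; omega
      · rcases j with _ | _ | j
        · left; simp
        · left; simp
        · right; omega
    exact hle hP
  let T' := T.restrict hmap
  have hker : LinearMap.ker T' ≠ ⊥ := by
    apply LinearMap.ker_ne_bot_of_finrank_lt
    rw [(degreeLTEquiv ℝ m).finrank_eq, (degreeLTEquiv ℝ (m + 1)).finrank_eq]
    simp
  obtain ⟨P, hP, hP0⟩ := Submodule.exists_mem_ne_zero_of_ne_bot hker
  refine ⟨P.1, fun h => hP0 (Subtype.ext h), ?_, ?_⟩
  · have := mem_degreeLT.1 P.2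
    by_cases h0 : P.1 = 0
    · simp [h0]
    · rw [← natDegree_lt_iff_degree_lt h0] at this
      omega
  · have := congrArg Subtype.val (LinearMap.mem_ker.1 hP)
    exact this

/-- Representation of third-order solutions. -/
lemma third_rep {q q' X0 X1 X2 : ℝ → ℝ} {l : ℝ} (hq : ∀ x, HasDerivAt q (q' x) x)
    (h0 : ∀ x, HasDerivAt X0 (X1 x) x) (h1 : ∀ x, HasDerivAt X1 (X2 x) x)
    (h2 : ∀ x, HasDerivAt X2 (4 * (q x - l) * X1 x + 2 * q' x * X0 x) x) (hX1 : X1 0 = 0)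
    {u u' v v' : ℝ → ℝ} (hu : NSol q l u u') (hv : DSol q l v v') (x : ℝ) :
    X0 x = X0 0 * u x ^ 2 + (X2 0 / 2 - (q 0 - l) * X0 0) * v x ^ 2 := by
  have hw := hv.1.lin hu.1 (u x) (- v x)
  set w : ℝ → ℝ := fun t => u x * v t + -v x * u t with hwdef
  set w' : ℝ → ℝ := fun t => u x * v' t + -v x * u' t with hw'def
  have hd : ∀ t, HasDerivAt (fun t => 2 * X0 t * w' t ^ 2 - 2 * (q t - l) * X0 t * w t ^ 2
      + X2 t * w t ^ 2 - 2 * X1 t * (w t * w' t)) 0 t := fun t => by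
    have e1 := ((h0 t).const_mul 2).mul ((hw.2 t).pow 2)
    have e2 := ((((hq t).sub_const l).const_mul 2).mul (h0 t)).mul ((hw.1 t).pow 2)
    have e3 := (h2 t).mul ((hw.1 t).pow 2)
    have e4 := ((h1 t).const_mul 2).mul ((hw.1 t).mul (hw.2 t))
    refine (((e1.sub e2).add e3).sub e4).congr_deriv ?_
    simp only [Pi.mul_apply, Pi.pow_apply]
    push_cast
    ring
  have hc := is_const_of_deriv_eq_zero (fun x => (hd x).differentiableAt)
    (fun x => (hd x).deriv) x 0
  have e0 : w x = 0 := by simp only [hwdef]; ring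
  have e1 : w' x = 1 := by
    have := hu.1.wronsk hv.1 x 0
    rw [hu.2.1, hu.2.2, hv.2.1, hv.2.2] at this
    simp only [hw'def]; linarith
  have e2 : w 0 = - v x := by simp [hwdef, hu.2.1, hv.2.1]
  have e3 : w' 0 = u x := by simp [hw'def, hu.2.2, hv.2.2]
  simp only [e0, e1, e2, e3, hX1] at hc
  linear_combination hc / 2

lemma Jac.s_inj {k K : ℝ} {s c d : ℝ → ℝ} (J : Jac k K s c d) : Set.InjOn s (Ioo (-K) K) := by
  intro x hx x' hx' h
  have h1 := J.sc x
  have h2 := J.sc x'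
  have h3 := J.c_pos x hx.1 hx.2
  have h4 := J.c_pos x' hx'.1 hx'.2
  rw [h] at h1
  have : c x = c x' := by nlinarith
  exact J.t_inj hx hx' (by simp only [h, this])

/-- homogenisation -/
def homP (m : ℕ) (P : ℝ[X]) : ℝ[X] :=
  ∑ j ∈ Finset.range (m + 1), C (P.coeff j) * (X ^ (2 * j) * (1 + X ^ 2) ^ (m - j))

lemma homP_deg (m : ℕ) (P : ℝ[X]) : (homP m P).natDegree ≤ 2 * m := by
  refine natDegree_sum_le_of_forall_le _ _ (fun j hj => ?_)
  rw [Finset.mem_range] at hj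
  refine (natDegree_C_mul_le _ _).trans (natDegree_mul_le.trans ?_)
  have h1 : ((1 + X ^ 2 : ℝ[X]) ^ (m - j)).natDegree ≤ (m - j) * 2 :=
    natDegree_pow_le_of_le _ (by compute_degree)
  rw [natDegree_X_pow]
  omega

lemma homP_eval {k K : ℝ} {s c d : ℝ → ℝ} (J : Jac k K s c d) {m : ℕ} {P : ℝ[X]}
    (hP : P.natDegree ≤ m) {x : ℝ} (hx : c x ≠ 0) :
    P.eval (s x ^ 2) = c x ^ (2 * m) * (homP m P).eval (s x / c x) := by
  rw [eval_eq_sum_range' (n := m + 1) (by omega), homP, eval_finsetSum, Finset.mul_sum]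
  refine Finset.sum_congr rfl (fun j hj => ?_)
  rw [Finset.mem_range] at hj
  have e : 1 + (s x / c x) ^ 2 = 1 / c x ^ 2 := by
    have := J.sc x
    field_simp; linarith
  simp only [eval_mul, eval_C, eval_pow, eval_X, eval_add, eval_one]
  rw [e, show c x ^ (2 * m) = (c x ^ 2) ^ (m - j) * (c x ^ 2) ^ j by
    rw [← pow_add, ← pow_mul]; congr 2; omega, pow_mul (s x / c x), div_pow, div_pow, div_pow]
  field_simp
  simp

lemma eval_s_sq_ne {k K : ℝ} {s c d : ℝ → ℝ} (J : Jac k K s c d) {P : ℝ[X]} (hP : P ≠ 0) :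
    ∃ x ∈ Ioo (-K) K, P.eval (s x ^ 2) ≠ 0 := by
  by_contra hcon
  push Not at hcon
  have h0 : P.comp (X ^ 2) = 0 := by
    refine eq_zero_of_infinite_isRoot _ (Set.Infinite.mono (s := s '' Ioo (-K) K) ?_ ?_)
    · rintro _ ⟨x, hx, rfl⟩
      simp only [Set.mem_ofPred_eq, IsRoot, eval_comp, eval_pow, eval_X]
      exact hcon x hx
    · exact (Ioo_infinite (by linarith [J.Kpos])).image J.s_inj
  rw [comp_eq_zero_iff] at h0
  rcases h0 with h0 | h0
  · exact hP h0
  · have := congrArg (fun p => coeff p 2) h0.2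
    simp [coeff_X_pow] at this

lemma closed_gap {k K : ℝ} {s c d : ℝ → ℝ} (J : Jac k K s c d) {m : ℕ} {a b : ℕ → ℝ}
    (O : Osc (lamePot m k s) K a b) {n : ℕ} (hn : m < n) : a n = b n := by
  have P := jac_pot J m
  obtain ⟨u, u', hu⟩ := O.exN (a n)
  obtain ⟨v, v', hv⟩ := O.exD (a n)
  obtain ⟨p, hp0, hpd, hp⟩ := lame_poly_exists m k (a n)
  have hpe : ∀ t, eval t (lameT ((m * (m + 1) : ℝ) * k ^ 2) k (a n) p) = 0 := fun t => by simp [hp]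
  have hZ : ∀ x, HasDerivAt (fun x => s x ^ 2) (2 * s x * c x * d x) x := fun x =>
    ((J.hs x).pow 2).congr_deriv (by push_cast; ring)
  have hZ2 : ∀ x, HasDerivAt (fun x => 2 * s x * c x * d x)
      (2 - 4 * (1 + k ^ 2) * s x ^ 2 + 6 * k ^ 2 * s x ^ 4) x := fun x => by
    refine ((((J.hs x).const_mul 2).mul (J.hc x)).mul (J.hd x)).congr_deriv ?_
    have e1 := J.sc x
    have e2 := J.dd x
    simp only [Pi.mul_apply]
    have e1' : c x ^ 2 = 1 - s x ^ 2 := by linarith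
    linear_combination (2 * c x ^ 2 - 2 * s x ^ 2) * e2 +
      (-2 * k ^ 2 * s x ^ 2 + 2 * (1 - k ^ 2 * s x ^ 2)) * e1
  let X0 : ℝ → ℝ := fun x => p.eval (s x ^ 2)
  let X1 : ℝ → ℝ := fun x => (derivative p).eval (s x ^ 2) * (2 * s x * c x * d x)
  let X2 : ℝ → ℝ := fun x => (derivative (derivative p)).eval (s x ^ 2) *
    (2 * s x * c x * d x) * (2 * s x * c x * d x) + (derivative p).eval (s x ^ 2) *
      (2 - 4 * (1 + k ^ 2) * s x ^ 2 + 6 * k ^ 2 * s x ^ 4)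
  have hev : ∀ (r : ℝ[X]) x, HasDerivAt (fun x => r.eval (s x ^ 2))
      ((derivative r).eval (s x ^ 2) * (2 * s x * c x * d x)) x := fun r x =>
    HasDerivAt.comp (h₂ := fun t => r.eval t) x (r.hasDerivAt (s x ^ 2)) (hZ x)
  have h0 : ∀ x, HasDerivAt X0 (X1 x) x := fun x => hev p x
  have h1 : ∀ x, HasDerivAt X1 (X2 x) x := fun x => (hev (derivative p) x).mul (hZ2 x)
  have hqd : ∀ x, HasDerivAt (lamePot m k s)
      ((m * (m + 1) : ℝ) * k ^ 2 * (2 * s x * c x * d x)) x := fun x => (hZ x).const_mul _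
  have h2 : ∀ x, HasDerivAt X2 (4 * (lamePot m k s x - a n) * X1 x +
      2 * ((m * (m + 1) : ℝ) * k ^ 2 * (2 * s x * c x * d x)) * X0 x) x := fun x => by
    have e0 : HasDerivAt (fun x => 2 - 4 * (1 + k ^ 2) * s x ^ 2 + 6 * k ^ 2 * s x ^ 4)
      ((-4 * (1 + k ^ 2) + 12 * k ^ 2 * s x ^ 2) * (2 * s x * c x * d x)) x := by
      refine ((((hZ x).const_mul (4 * (1 + k ^ 2))).const_sub 2).add
        (((J.hs x).pow 4).const_mul (6 * k ^ 2))).congr_deriv ?_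
      push_cast; ring
    refine ((((hev (derivative (derivative p)) x).mul (hZ2 x)).mul (hZ2 x)).add
      ((hev (derivative p) x).mul e0)).congr_deriv ?_
    have hh := hpe (s x ^ 2)
    simp only [lameT, LinearMap.coe_mk, AddHom.coe_mk, eval_sub, eval_add, eval_mul, eval_X, eval_C,
      eval_one, eval_pow, eval_ofNat] at hh
    simp only [X0, X1, lamePot, Pi.mul_apply]
    have ef : (2 * s x * c x * d x) ^ 2 = 4 * s x ^ 2 * (1 - s x ^ 2) * (1 - k ^ 2 * s x ^ 2) := by
      rw [← J.dd x, show 1 - s x ^ 2 = c x ^ 2 by linarith [J.sc x]]; ring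
    linear_combination (2 * s x * c x * d x) * hh + eval (s x ^ 2) (derivative (derivative (derivative p))) * (2 * s x * c x * d x) * ef
  have s0 : s 0 = 0 := by have := J.s_odd 0; simp at this; linarith
  have hrep := third_rep hqd h0 h1 h2 (by simp [X1, s0]) hu hv
  set γ := X0 0
  set α := X2 0 / 2 - (lamePot m k s 0 - a n) * X0 0
  have hperN := O.perN n _ _ hu
  by_cases hα : α = 0
  · -- only the even square
    exfalso
    obtain ⟨S, hS, hS2⟩ := O.zeroN n _ _ hu
    have hne : homP m p ≠ 0 := by
      intro h
      obtain ⟨x, hx, hx2⟩ := eval_s_sq_ne J hp0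
      apply hx2
      rw [homP_eval J hpd (J.c_pos x hx.1 hx.2).ne', h]; simp
    have := lemmaZ J hu.1.1 hS hS2 hne (homP_deg m p) γ (fun x hx => by
      rw [← homP_eval J hpd (J.c_pos x hx.1 hx.2).ne']
      have := hrep x
      rw [hα] at this
      simp only [X0] at this
      rw [this]; ring)
    omega
  · have hX : X0 (2 * K) = X0 0 := by
      have := J.s_per 0
      rw [zero_add] at this
      simp only [X0, this, neg_sq]
    have hu2 := hperN 0
    rw [zero_add, hu.2.1, mul_one] at hu2
    have hv2 : v (2 * K) = 0 := by
      have h3 := hrep (2 * K)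
      rw [hX, hu2, ← pow_mul, mul_comm n 2, pow_mul] at h3
      norm_num at h3
      have h4 : α * v (2 * K) ^ 2 = 0 := by
        simp only [γ] at h3
        linarith
      have h5 := (mul_eq_zero.1 h4).resolve_left hα
      exact pow_eq_zero_iff (two_ne_zero) |>.1 h5
    have hw := hu.1.wronsk hv.1 (2 * K) 0
    rw [hu2, hv2, hu.2.1, hu.2.2, hv.2.1, hv.2.2] at hw
    have hρ : v' (2 * K) = (-1) ^ n := by
      have : ((-1 : ℝ) ^ n) ^ 2 = 1 := by rw [← pow_mul, mul_comm n 2, pow_mul]; norm_num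
      linear_combination (-1) ^ n * hw - v' (2 * K) * this
    have hperD : ∀ x, v (x + 2 * K) = (-1) ^ n * v x := fun x =>
      ((hv.1.shift (2 * K) P.per).uniq P.cont (hv.1.smul ((-1) ^ n)) (x₀ := 0)
        (by simp [hv2, hv.2.1]) (by simp [hρ, hv.2.2]) x).1
    obtain ⟨j, hj1, hj, -⟩ := O.ofD _ _ _ _ hv (neg_one_pow_eq_or ℝ n) hperD
    have := O.a_eq_b hj1 hj.symm
    rw [this]; rw [this] at hj; exact hj.symm
end

def lamA (M : ℕ) (k e : ℝ) (j' j : ℕ) : ℝ :=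
  (if j' = j then 2 * ((M : ℝ) - j) * j + M + k ^ 2 * ((j : ℝ) + e) ^ 2 else 0)
  + (if j' + 2 = j then -((j : ℝ) * (j - 1)) else 0)
  + (if j' = j + 2 then -(((M : ℝ) - j) * (M - j - 1) * (1 - k ^ 2)) else 0)

def lamW (M : ℕ) (k : ℝ) (j : ℕ) : ℝ := (M.choose j : ℝ) * Real.sqrt (1 - k ^ 2) ^ j

lemma lamW_pos {M : ℕ} {k : ℝ} (hk0 : 0 < k) (hk1 : k < 1) {j : ℕ} (hj : j ≤ M) :
    0 < lamW M k j := by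
  have : 0 < Real.sqrt (1 - k ^ 2) := Real.sqrt_pos.2 (by nlinarith)
  have : 0 < M.choose j := Nat.choose_pos hj
  unfold lamW
  positivity

lemma lamW_step {M : ℕ} {k : ℝ} (hk0 : 0 < k) (hk1 : k < 1) {j : ℕ} (hj : j + 2 ≤ M) :
    ((j : ℝ) + 2) * (j + 1) * lamW M k (j + 2) = ((M : ℝ) - j) * (M - j - 1) * (1 - k ^ 2) * lamW M k j := by
  have hs : Real.sqrt (1 - k ^ 2) ^ 2 = 1 - k ^ 2 := Real.sq_sqrt (by nlinarith)
  have h1 := Nat.choose_succ_right_eq M j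
  have h2 := Nat.choose_succ_right_eq M (j + 1)
  have h1' : (M.choose (j + 1) : ℝ) * (j + 1) = M.choose j * (M - j) := by
    have := congrArg (Nat.cast (R := ℝ)) h1
    rw [Nat.cast_mul, Nat.cast_mul, Nat.cast_sub (by omega)] at this
    push_cast at this; exact this
  have h2' : (M.choose (j + 2) : ℝ) * (j + 2) = M.choose (j + 1) * (M - j - 1) := by
    have := congrArg (Nat.cast (R := ℝ)) h2
    rw [Nat.cast_mul, Nat.cast_mul, Nat.cast_sub (by omega)] at this
    push_cast at this
    rw [show j + 1 + 1 = j + 2 from rfl] at this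
    linarith
  unfold lamW
  rw [pow_add, hs]
  linear_combination (Real.sqrt (1 - k ^ 2) ^ j * (1 - k ^ 2)) * ((j + 1) * h2' + (M - j - 1) * h1')

lemma lamA_symm {M : ℕ} {k e : ℝ} (hk0 : 0 < k) (hk1 : k < 1) {j j' : ℕ} (hj : j ≤ M) (hj' : j' ≤ M) :
    lamA M k e j j' * lamW M k j' = lamA M k e j' j * lamW M k j := by
  by_cases h1 : j = j'
  · subst h1; rfl
  by_cases h2 : j' = j + 2
  · subst h2
    have := lamW_step hk0 hk1 hj'
    simp only [lamA, h1, Ne.symm h1, if_true, if_false, show ¬ (j = j + 2 + 2) by omega,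
      show ¬ (j + 2 + 2 = j) by omega]
    simp
    linear_combination this
  by_cases h3 : j = j' + 2
  · subst h3
    have := lamW_step hk0 hk1 hj
    simp only [lamA, h1, Ne.symm h1, if_true, if_false, show ¬ (j' = j' + 2 + 2) by omega,
      show ¬ (j' + 2 + 2 = j') by omega]
    simp
    linear_combination -this
  · simp only [lamA, h1, Ne.symm h1, h2, h3, if_false, show ¬ (j + 2 = j') by omega,
      show ¬ (j' + 2 = j) by omega]
    simp

lemma lam_eig (M : ℕ) {k : ℝ} (e : ℝ) (hk0 : 0 < k) (hk1 : k < 1) :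
    ∃ (μ : Fin (M + 1) → ℝ) (v : Fin (M + 1) → ℕ → ℝ),
      (∀ i, ∀ j, j ≤ M → ∑ j' ∈ Finset.range (M + 1), lamA M k e j j' * v i j' = μ i * v i j) ∧
      (∀ i i', i ≠ i' → ∀ α β : ℝ, (∀ j, j ≤ M → α * v i j + β * v i' j = 0) → α = 0 ∧ β = 0) ∧
      (∀ i, ∃ j, j ≤ M ∧ v i j ≠ 0) := by
  classical
  let w : ℕ → ℝ := fun j => Real.sqrt (lamW M k j)
  have hw : ∀ j, j ≤ M → 0 < w j := fun j hj => Real.sqrt_pos.2 (lamW_pos hk0 hk1 hj)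
  have hw2 : ∀ j, j ≤ M → w j ^ 2 = lamW M k j := fun j hj => Real.sq_sqrt (lamW_pos hk0 hk1 hj).le
  let S : Matrix (Fin (M + 1)) (Fin (M + 1)) ℝ := Matrix.of fun j j' => lamA M k e j j' * (w j' / w j)
  have hS : S.IsHermitian := by
    ext j j'
    have hj : (j : ℕ) ≤ M := by omega
    have hj' : (j' : ℕ) ≤ M := by omega
    have h1 := hw _ hj
    have h2 := hw _ hj'
    have h3 := lamA_symm (e := e) hk0 hk1 hj hj'
    rw [← hw2 _ hj, ← hw2 _ hj'] at h3
    simp only [Matrix.conjTranspose_apply, S, Matrix.of_apply, star_trivial]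
    field_simp
    linarith
  let x := hS.eigenvectorBasis
  refine ⟨hS.eigenvalues, fun i j => if h : j < M + 1 then w j * x i ⟨j, h⟩ else 0, ?_, ?_, ?_⟩
  · intro i j hj
    have h1 := congrFun (hS.mulVec_eigenvectorBasis i) ⟨j, by omega⟩
    simp only [Matrix.mulVec, dotProduct, S, Matrix.of_apply, Pi.smul_apply, smul_eq_mul] at h1
    beta_reduce
    rw [dif_pos (show j < M + 1 by omega), Finset.sum_range]
    have hwj := hw j hj
    have : ∀ j' : Fin (M + 1), lamA M k e j j' * (if h : (j' : ℕ) < M + 1 then w j' * x i ⟨j', h⟩ else 0)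
        = w j * (lamA M k e j j' * (w j' / w j) * x i j') := by
      intro j'
      rw [dif_pos j'.2]
      field_simp
    rw [Finset.sum_congr rfl (fun j' _ => this j'), ← Finset.mul_sum]
    rw [h1]
    ring
  · intro i i' hii α β h
    have hli := x.orthonormal.linearIndependent
    have hpair := hli.comp ![i, i'] (by
      intro p q hpq
      fin_cases p <;> fin_cases q <;> simp_all)
    have he : (x ∘ ![i, i']) = ![x i, x i'] := by
      funext p
      fin_cases p <;> rfl
    rw [he] at hpair
    have h2 := LinearIndependent.pair_iff.1 hpair
    apply h2
    ext j
    have h3 := h j (by omega)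
    beta_reduce at h3
    rw [dif_pos j.2, dif_pos j.2] at h3
    have hwj := hw j (by omega)
    have h4 : w j * (α * x i j + β * x i' j) = 0 := by rw [← h3]; ring
    have := (mul_eq_zero.1 h4).resolve_left hwj.ne'
    simpa using this
  · intro i
    by_contra hcon
    push Not at hcon
    have : x i = 0 := by
      ext j
      have h3 := hcon j (by omega)
      beta_reduce at h3
      rw [dif_pos j.2] at h3
      have hwj := hw j (by omega)
      exact (mul_eq_zero.1 h3).resolve_left hwj.ne'
    exact x.orthonormal.ne_zero i this

section
open Polynomial

def mF (s c : ℝ → ℝ) (i j : ℕ) (x : ℝ) : ℝ := c x ^ i * s x ^ j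
def mP (s c : ℝ → ℝ) (i j : ℕ) (x : ℝ) : ℝ := -(i * mF s c (i - 1) (j + 1) x) + j * mF s c (i + 1) (j - 1) x
def mQ (s c : ℝ → ℝ) (i j : ℕ) (x : ℝ) : ℝ := -(i * mP s c (i - 1) (j + 1) x) + j * mP s c (i + 1) (j - 1) x

lemma mF_deriv {k K : ℝ} {s c d : ℝ → ℝ} (J : Jac k K s c d) (i j : ℕ) (x : ℝ) :
    HasDerivAt (mF s c i j) (d x * mP s c i j x) x := by
  refine (((J.hc x).pow i).mul ((J.hs x).pow j)).congr_deriv ?_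
  simp only [mP, mF, Pi.pow_apply]
  ring

lemma mP_deriv {k K : ℝ} {s c d : ℝ → ℝ} (J : Jac k K s c d) (i j : ℕ) (x : ℝ) :
    HasDerivAt (mP s c i j) (d x * mQ s c i j x) x := by
  refine (((mF_deriv J (i - 1) (j + 1) x).const_mul (i : ℝ)).neg.add
    ((mF_deriv J (i + 1) (j - 1) x).const_mul (j : ℝ))).congr_deriv ?_
  simp only [mQ]
  ring

lemma m_key {k K : ℝ} {s c d : ℝ → ℝ} (J : Jac k K s c d) (i j : ℕ) (x : ℝ) {e m : ℝ}
    (he : e = 0 ∨ e = 1) (hm : (i : ℝ) + j + e = m) :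
    m * (m + 1) * k ^ 2 * s x ^ 2 * mF s c i j x -
      (-(k ^ 2 * e * (c x ^ 2 - s x ^ 2) * mF s c i j x) - (1 + 2 * e) * k ^ 2 * (s x * c x * mP s c i j x)
        + d x ^ 2 * mQ s c i j x)
    = (2 * i * j + i + j + k ^ 2 * (j + e) ^ 2) * mF s c i j x
      - j * (j - 1) * mF s c (i + 2) (j - 2) x - i * (i - 1) * (1 - k ^ 2) * mF s c (i - 2) (j + 2) x := by
  have h1 : s x * c x * mP s c i j x = (-(i * s x ^ 2) + j * c x ^ 2) * mF s c i j x := by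
    simp only [mP, mF]
    rcases i with _ | i <;> rcases j with _ | j <;> simp <;> ring
  have h2 : mQ s c i j x = i * (i - 1) * mF s c (i - 2) (j + 2) x - (2 * i * j + i + j) * mF s c i j x
      + j * (j - 1) * mF s c (i + 2) (j - 2) x := by
    simp only [mQ, mP]
    rcases i with _ | i <;> rcases j with _ | j <;> simp <;> ring
  have h3 : (i : ℝ) * (i - 1) * c x ^ 2 * mF s c (i - 2) (j + 2) x = i * (i - 1) * s x ^ 2 * mF s c i j x := by
    simp only [mF]
    rcases i with _ | _ | i
    · simp
    · simp
    · rw [show i + 1 + 1 - 2 = i from rfl]; ring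
  have h4 : (j : ℝ) * (j - 1) * s x ^ 2 * mF s c (i + 2) (j - 2) x = j * (j - 1) * c x ^ 2 * mF s c i j x := by
    simp only [mF]
    rcases j with _ | _ | j
    · simp
    · simp
    · rw [show j + 1 + 1 - 2 = j from rfl]; ring
  have sc := J.sc x
  have dd := J.dd x
  generalize mF s c (i - 2) (j + 2) x = Fm at *
  generalize mF s c (i + 2) (j - 2) x = Fp at *
  generalize mF s c i j x = F at *
  rw [h1, h2]
  subst hm
  rcases he with rfl | rfl
  · linear_combination dd * (-(i * (i - 1) * Fm - (2 * i * j + i + j) * F + j * (j - 1) * Fp))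
      + sc * (k ^ 2 * i * (i - 1) * Fm) - k ^ 2 * h3 + k ^ 2 * h4 + sc * (k ^ 2 * (j + 0) ^ 2 * F)
  · linear_combination dd * (-(i * (i - 1) * Fm - (2 * i * j + i + j) * F + j * (j - 1) * Fp))
      + sc * (k ^ 2 * i * (i - 1) * Fm) - k ^ 2 * h3 + k ^ 2 * h4 + sc * (k ^ 2 * (j + 1) ^ 2 * F)

lemma lamA_sum (M : ℕ) (k e : ℝ) (g : ℕ → ℝ) {j : ℕ} (hj : j ≤ M) :
    ∑ j' ∈ Finset.range (M + 1), lamA M k e j' j * g j'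
      = (2 * ((M : ℝ) - j) * j + M + k ^ 2 * (j + e) ^ 2) * g j - j * (j - 1) * g (j - 2)
        - (M - j) * (M - j - 1) * (1 - k ^ 2) * g (j + 2) := by
  simp only [lamA, add_mul, Finset.sum_add_distrib, ite_mul, zero_mul]
  have h1 : j ∈ Finset.range (M + 1) := by simp; omega
  rw [Finset.sum_ite_eq', if_pos h1, Finset.sum_ite_eq']
  have h2 : (∑ x ∈ Finset.range (M + 1), if x + 2 = j then -((j : ℝ) * (j - 1)) * g x else 0)
      = -((j : ℝ) * (j - 1)) * g (j - 2) := by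
    rcases j with _ | _ | j
    · simp
    · simp
    · have : ∀ x, (x + 2 = j + 1 + 1) = (x = j) := fun x => by simp
      simp only [this]
      rw [Finset.sum_ite_eq', if_pos (by simp; omega)]
      rfl
  rw [h2]
  split_ifs with h3
  · ring
  · have : ((M : ℝ) - j) * (M - j - 1) = 0 := by
      simp at h3
      have : M = j ∨ M = j + 1 := by omega
      rcases this with rfl | rfl
      · simp
      · push_cast; ring
    linear_combination ((1 - k ^ 2) * g (j + 2)) * this

structure Lam (q : ℝ → ℝ) (K : ℝ) (s c d : ℝ → ℝ) (M ε : ℕ) (μ : ℝ) (p : ℝ[X]) (u z : ℝ → ℝ) : Prop where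
  sol : IsSol q μ u z
  per : ∀ x, u (x + 2 * K) = (-1) ^ M * u x
  form : ∀ x ∈ Ioo (-K) K, u x = d x ^ ε * c x ^ M * p.eval (s x / c x)
  deg : p.natDegree ≤ M

def sF (s c : ℝ → ℝ) (M : ℕ) (v : ℕ → ℝ) (x : ℝ) : ℝ := ∑ j ∈ Finset.range (M + 1), v j * mF s c (M - j) j x
def sP (s c : ℝ → ℝ) (M : ℕ) (v : ℕ → ℝ) (x : ℝ) : ℝ := ∑ j ∈ Finset.range (M + 1), v j * mP s c (M - j) j x
def sQ (s c : ℝ → ℝ) (M : ℕ) (v : ℕ → ℝ) (x : ℝ) : ℝ := ∑ j ∈ Finset.range (M + 1), v j * mQ s c (M - j) j x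
def sPol (M : ℕ) (v : ℕ → ℝ) : ℝ[X] := ∑ j ∈ Finset.range (M + 1), C (v j) * X ^ j

lemma sPol_coeff (M : ℕ) (v : ℕ → ℝ) {j : ℕ} (hj : j ≤ M) : (sPol M v).coeff j = v j := by
  simp only [sPol, finsetSum_coeff, coeff_C_mul_X_pow]
  rw [Finset.sum_ite_eq, if_pos (by simp; omega)]

lemma sPol_deg (M : ℕ) (v : ℕ → ℝ) : (sPol M v).natDegree ≤ M := by
  refine natDegree_sum_le_of_forall_le _ _ (fun j hj => ?_)
  rw [Finset.mem_range] at hj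
  exact (natDegree_C_mul_X_pow_le _ _).trans (by omega)

lemma sF_deriv {k K : ℝ} {s c d : ℝ → ℝ} (J : Jac k K s c d) (M : ℕ) (v : ℕ → ℝ) (x : ℝ) :
    HasDerivAt (sF s c M v) (d x * sP s c M v x) x := by
  refine (HasDerivAt.fun_sum (fun j _ => (mF_deriv J (M - j) j x).const_mul (v j))).congr_deriv ?_
  rw [sP, Finset.mul_sum]
  exact Finset.sum_congr rfl (fun j _ => by ring)

lemma sP_deriv {k K : ℝ} {s c d : ℝ → ℝ} (J : Jac k K s c d) (M : ℕ) (v : ℕ → ℝ) (x : ℝ) :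
    HasDerivAt (sP s c M v) (d x * sQ s c M v x) x := by
  refine (HasDerivAt.fun_sum (fun j _ => (mP_deriv J (M - j) j x).const_mul (v j))).congr_deriv ?_
  rw [sQ, Finset.mul_sum]
  exact Finset.sum_congr rfl (fun j _ => by ring)

lemma sF_per {k K : ℝ} {s c d : ℝ → ℝ} (J : Jac k K s c d) (M : ℕ) (v : ℕ → ℝ) (x : ℝ) :
    sF s c M v (x + 2 * K) = (-1) ^ M * sF s c M v x := by
  rw [sF, sF, Finset.mul_sum]
  refine Finset.sum_congr rfl (fun j hj => ?_)
  rw [Finset.mem_range] at hj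
  simp only [mF, J.s_per, J.c_per]
  rw [neg_pow (c x), neg_pow (s x)]
  have : (-1 : ℝ) ^ M = (-1) ^ (M - j) * (-1) ^ j := by rw [← pow_add]; congr 1; omega
  rw [this]; ring

lemma sF_form {s c : ℝ → ℝ} (M : ℕ) (v : ℕ → ℝ) {x : ℝ} (hx : c x ≠ 0) :
    sF s c M v x = c x ^ M * (sPol M v).eval (s x / c x) := by
  rw [sF, sPol, eval_finsetSum, Finset.mul_sum]
  refine Finset.sum_congr rfl (fun j hj => ?_)
  rw [Finset.mem_range] at hj
  simp only [mF, eval_mul, eval_C, eval_pow, eval_X]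
  have : c x ^ M = c x ^ (M - j) * c x ^ j := by rw [← pow_add]; congr 1; omega
  rw [this, div_pow]
  field_simp

lemma s_key {k K : ℝ} {s c d : ℝ → ℝ} (J : Jac k K s c d) (M : ℕ) (v : ℕ → ℝ) (x : ℝ) {e m μ : ℝ}
    (he : e = 0 ∨ e = 1) (hm : (M : ℝ) + e = m)
    (hv : ∀ j, j ≤ M → ∑ j' ∈ Finset.range (M + 1), lamA M k e j j' * v j' = μ * v j) :
    m * (m + 1) * k ^ 2 * s x ^ 2 * sF s c M v x -
      (-(k ^ 2 * e * (c x ^ 2 - s x ^ 2) * sF s c M v x) - (1 + 2 * e) * k ^ 2 * (s x * c x * sP s c M v x)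
        + d x ^ 2 * sQ s c M v x) = μ * sF s c M v x := by
  have h1 : ∀ j ∈ Finset.range (M + 1), v j * (m * (m + 1) * k ^ 2 * s x ^ 2 * mF s c (M - j) j x -
      (-(k ^ 2 * e * (c x ^ 2 - s x ^ 2) * mF s c (M - j) j x) - (1 + 2 * e) * k ^ 2 * (s x * c x * mP s c (M - j) j x)
        + d x ^ 2 * mQ s c (M - j) j x)) =
      v j * ∑ j' ∈ Finset.range (M + 1), lamA M k e j' j * mF s c (M - j') j' x := by
    intro j hj
    have hj : j ≤ M := by simp at hj; omega
    rw [lamA_sum M k e (fun j' => mF s c (M - j') j' x) hj]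
    have hc : ((M - j : ℕ) : ℝ) = M - j := Nat.cast_sub hj
    rw [m_key J (M - j) j x he (by rw [hc]; linarith), hc]
    have e1 : (j : ℝ) * (j - 1) * mF s c (M - (j - 2)) (j - 2) x =
        j * (j - 1) * mF s c (M - j + 2) (j - 2) x := by
      rcases j with _ | _ | j
      · simp
      · simp
      · rw [show M - (j + 1 + 1 - 2) = M - (j + 1 + 1) + 2 by omega]
    rw [e1, show M - (j + 2) = M - j - 2 by omega]
    ring
  have h2 := Finset.sum_congr rfl h1
  have h3 : ∑ j ∈ Finset.range (M + 1), v j * ∑ j' ∈ Finset.range (M + 1), lamA M k e j' j * mF s c (M - j') j' x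
      = μ * sF s c M v x := by
    simp only [Finset.mul_sum]
    rw [Finset.sum_comm, sF, Finset.mul_sum]
    refine Finset.sum_congr rfl (fun j hj => ?_)
    have hj : j ≤ M := by simp at hj; omega
    rw [← mul_assoc, ← hv j hj, Finset.sum_mul]
    exact Finset.sum_congr rfl (fun j' _ => by ring)
  rw [← h3, ← h2]
  simp only [sF, sP, sQ, Finset.mul_sum, ← Finset.sum_neg_distrib, ← Finset.sum_sub_distrib,
    ← Finset.sum_add_distrib]
  exact Finset.sum_congr rfl (fun j _ => by ring)

lemma lam0 {k K : ℝ} {s c d : ℝ → ℝ} (J : Jac k K s c d) (m : ℕ) (v : ℕ → ℝ) {μ : ℝ}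
    (hv : ∀ j, j ≤ m → ∑ j' ∈ Finset.range (m + 1), lamA m k 0 j j' * v j' = μ * v j) :
    ∃ u z, Lam (lamePot m k s) K s c d m 0 μ (sPol m v) u z := by
  refine ⟨sF s c m v, fun x => d x * sP s c m v x, ⟨fun x => sF_deriv J m v x, fun x => ?_⟩,
    sF_per J m v, fun x hx => ?_, sPol_deg m v⟩
  · refine ((J.hd x).mul (sP_deriv J m v x)).congr_deriv ?_
    have := s_key J m v x (Or.inl rfl) (m := (m : ℝ)) (by simp) hv
    simp only [lamePot]
    linear_combination -this
  · rw [sF_form m v (J.c_pos x hx.1 hx.2).ne']; ring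

lemma lam1 {k K : ℝ} {s c d : ℝ → ℝ} (J : Jac k K s c d) {M m : ℕ} (hM : M + 1 = m) (v : ℕ → ℝ) {μ : ℝ}
    (hv : ∀ j, j ≤ M → ∑ j' ∈ Finset.range (M + 1), lamA M k 1 j j' * v j' = μ * v j) :
    ∃ u z, Lam (lamePot m k s) K s c d M 1 μ (sPol M v) u z := by
  refine ⟨fun x => d x * sF s c M v x, fun x => -(k ^ 2 * s x * c x) * sF s c M v x + d x ^ 2 * sP s c M v x,
    ⟨fun x => ?_, fun x => ?_⟩, fun x => ?_, fun x hx => ?_, sPol_deg M v⟩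
  · refine ((J.hd x).mul (sF_deriv J M v x)).congr_deriv ?_
    ring
  · refine (((((J.hs x).const_mul (k ^ 2)).mul (J.hc x)).neg.mul (sF_deriv J M v x)).add
      (((J.hd x).pow 2).mul (sP_deriv J M v x))).congr_deriv ?_
    have := s_key J M v x (Or.inr rfl) (m := (m : ℝ)) (by rw [← hM]; push_cast; ring) hv
    simp only [lamePot, Pi.neg_apply, Pi.mul_apply, Pi.pow_apply]
    push_cast
    linear_combination (-d x) * this
  · rw [sF_per J, J.d_per]; ring
  · rw [sF_form M v (J.c_pos x hx.1 hx.2).ne']; ring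

end

section
open Polynomial

lemma Jac.one_add {k K : ℝ} {s c d : ℝ → ℝ} (J : Jac k K s c d) {x : ℝ} (h : c x ≠ 0) :
    c x ^ 2 * (1 + (s x / c x) ^ 2) = 1 := by
  have := J.sc x
  field_simp; linarith

lemma Jac.d_t {k K : ℝ} {s c d : ℝ → ℝ} (J : Jac k K s c d) {x : ℝ} (h : c x ≠ 0) :
    d x ^ 2 = c x ^ 2 * (1 + (1 - k ^ 2) * (s x / c x) ^ 2) := by
  have h1 := J.sc x
  have h2 := J.dd x
  field_simp; linear_combination h2 - h1

/-- the Wronskian constant vanishes -/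
lemma poly_no {k C0 : ℝ} (hk0 : 0 < k) (hk1 : k < 1) (N n : ℕ) (w : ℝ[X])
    (h : C (C0 ^ 2) * (1 + X ^ 2) ^ N = (1 + X ^ 2) ^ 2 * (1 + C (1 - k ^ 2) * X ^ 2) ^ (n + 1) * w ^ 2) :
    C0 = 0 := by
  have hk : 0 < 1 - k ^ 2 := by nlinarith
  set r := Real.sqrt (1 - k ^ 2) with hr
  have hr0 : 0 < r := Real.sqrt_pos.2 hk
  have hr2 : r ^ 2 = 1 - k ^ 2 := Real.sq_sqrt hk.le
  have h1 := congrArg (aeval (Complex.I / (r : ℂ))) h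
  simp only [map_mul, map_pow, map_add, map_one, aeval_C, aeval_X, Complex.coe_algebraMap] at h1
  have hrc : (r : ℂ) ≠ 0 := by exact_mod_cast hr0.ne'
  have e1 : (1 : ℂ) + ((1 - k ^ 2 : ℝ) : ℂ) * (Complex.I / r) ^ 2 = 0 := by
    rw [← hr2]
    push_cast
    field_simp
    rw [Complex.I_sq]; ring
  rw [e1, pow_succ (0 : ℂ) n, mul_zero, mul_zero, zero_mul] at h1
  have e2 : (1 : ℂ) + (Complex.I / r) ^ 2 ≠ 0 := by
    have : (1 : ℂ) + (Complex.I / r) ^ 2 = ((-(k ^ 2) / r ^ 2 : ℝ) : ℂ) := by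
      rw [div_pow, Complex.I_sq]
      have h3 : (r : ℂ) ^ 2 = 1 - k ^ 2 := by exact_mod_cast hr2
      push_cast
      field_simp
      linear_combination h3
    rw [this]
    norm_cast
    have : 0 < k ^ 2 / r ^ 2 := by positivity
    rw [neg_div]
    linarith
  have := (mul_eq_zero.1 h1).resolve_right (pow_ne_zero _ e2)
  have h4 : (C0 : ℝ) ^ 2 = 0 := by
    have h5 : ((C0 ^ 2 : ℝ) : ℂ) = 0 := by simpa using this
    exact_mod_cast h5
  exact pow_eq_zero_iff (two_ne_zero) |>.1 h4

lemma Lam.wr {k K μ : ℝ} {s c d : ℝ → ℝ} (J : Jac k K s c d) {q : ℝ → ℝ} {M ε : ℕ} {p p' : ℝ[X]}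
    {u z u' z' : ℝ → ℝ} (h : Lam q K s c d M ε μ p u z) (h' : Lam q K s c d M ε μ p' u' z') :
    u 0 * z' 0 - z 0 * u' 0 = 0 := by
  set C0 := u 0 * z' 0 - z 0 * u' 0 with hC
  have hz : ∀ {p : ℝ[X]} {u z : ℝ → ℝ}, Lam q K s c d M ε μ p u z → ∀ x ∈ Ioo (-K) K,
      z x = deriv (fun x => d x ^ ε * c x ^ M) x * p.eval (s x / c x)
        + d x ^ ε * c x ^ M * (p.derivative.eval (s x / c x) * (d x / c x ^ 2)) := by
    intro p u z h x hx
    have hd : DifferentiableAt ℝ (fun x => d x ^ ε * c x ^ M) x :=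
      ((J.hd x).differentiableAt.pow ε).mul ((J.hc x).differentiableAt.pow M)
    have hp : HasDerivAt (fun x => p.eval (s x / c x)) (p.derivative.eval (s x / c x) * (d x / c x ^ 2)) x :=
      HasDerivAt.comp x (h₂ := fun y => p.eval y) (p.hasDerivAt (s x / c x)) (J.t_deriv (J.c_pos x hx.1 hx.2).ne')
    have h1 := hd.hasDerivAt.mul hp
    have h2 : HasDerivAt u _ x := h1.congr_of_eventuallyEq
      ((isOpen_Ioo.eventually_mem hx).mono (fun y hy => h.form y hy))
    exact (h.sol.1 x).unique h2
  refine poly_no J.hk0 J.hk1 (2 * M + 2 * ε + 1) (2 * ε) (p * derivative p' - derivative p * p') ?_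
  rw [← sub_eq_zero]
  refine J.poly_zero _ (fun x hx => ?_)
  have hc := (J.c_pos x hx.1 hx.2).ne'
  have hw := h.sol.wronsk h'.sol x 0
  rw [← hC, hz h x hx, hz h' x hx, h.form x hx, h'.form x hx] at hw
  have o := J.one_add hc
  have dt := J.d_t hc
  simp only [eval_sub, eval_mul, eval_add, eval_pow, eval_C, eval_X, eval_one]
  generalize hW : eval (s x / c x) p * eval (s x / c x) (derivative p') - eval (s x / c x) (derivative p) * eval (s x / c x) p' = W
  have hw2 : C0 * c x ^ 2 = d x ^ (2 * ε + 1) * c x ^ (2 * M) * W := by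
    rw [← hw, ← hW]
    field_simp
    ring
  set t := s x / c x
  set R := 1 + t ^ 2
  set D := 1 + (1 - k ^ 2) * t ^ 2
  have hR : R ≠ 0 := by positivity
  have e1 : C0 ^ 2 * (c x ^ 2) ^ 2 = (c x ^ 2 * D) ^ (2 * ε + 1) * (c x ^ 2) ^ (2 * M) * W ^ 2 := by
    rw [← dt, ← mul_pow, hw2]; ring
  have e2 := congrArg (fun y => y * R ^ (2 * M + 2 * ε + 1) * R ^ 2) e1
  beta_reduce at e2
  have e3 : C0 ^ 2 * (c x ^ 2) ^ 2 * R ^ (2 * M + 2 * ε + 1) * R ^ 2 = C0 ^ 2 * R ^ (2 * M + 2 * ε + 1) * (c x ^ 2 * R) ^ 2 := by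
    ring
  have e4 : (c x ^ 2 * D) ^ (2 * ε + 1) * (c x ^ 2) ^ (2 * M) * W ^ 2 * R ^ (2 * M + 2 * ε + 1) * R ^ 2
      = D ^ (2 * ε + 1) * W ^ 2 * R ^ 2 * (c x ^ 2 * R) ^ (2 * M + 2 * ε + 1) := by
    ring
  rw [e3, e4, o, one_pow, one_pow] at e2
  linear_combination e2

lemma Lam.indep {k K μ : ℝ} {s c d : ℝ → ℝ} (J : Jac k K s c d) {q : ℝ → ℝ} (hq : Continuous q) {M ε : ℕ}
    {p p' : ℝ[X]} {u z u' z' : ℝ → ℝ} (h : Lam q K s c d M ε μ p u z) (h' : Lam q K s c d M ε μ p' u' z')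
    (hi : ∀ α β : ℝ, C α * p + C β * p' = 0 → α = 0 ∧ β = 0) : False := by
  have hw := h.wr J h'
  have key : ∀ α β : ℝ, (∀ x, α * u x + β * u' x = 0) → α = 0 ∧ β = 0 := by
    intro α β hab
    refine hi α β (J.poly_zero _ (fun x hx => ?_))
    have h1 := hab x
    have hc := J.c_pos x hx.1 hx.2
    have hd := J.dpos x
    rw [h.form x hx, h'.form x hx] at h1
    have h2 : d x ^ ε * c x ^ M * (eval (s x / c x) (C α * p + C β * p')) = 0 := by
      rw [← h1]; simp only [eval_add, eval_mul, eval_C]; ring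
    exact (mul_eq_zero.1 h2).resolve_left (by positivity)
  have h1 := key (u' 0) (-u 0) (fun x => ((h.sol.lin h'.sol (u' 0) (-u 0)).zero_of hq (x₀ := 0)
    (by ring) (by linarith) x).1)
  have h2 := key (z' 0) (-z 0) (fun x => ((h.sol.lin h'.sol (z' 0) (-z 0)).zero_of hq (x₀ := 0)
    (by linarith) (by ring) x).1)
  have h3 := key 1 0 (fun x => by
    rw [(h.sol.zero_of hq (x₀ := 0) (by linarith [h1.2]) (by linarith [h2.2]) x).1]; ring)
  exact one_ne_zero h3.1

lemma Lam.index {k K μ : ℝ} {s c d : ℝ → ℝ} (J : Jac k K s c d) {m M ε : ℕ} {a b : ℕ → ℝ}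
    (O : Osc (lamePot m k s) K a b) (hM : M + ε = m)
    {p : ℝ[X]} {u z : ℝ → ℝ} (h : Lam (lamePot m k s) K s c d M ε μ p u z) (hp : p ≠ 0) :
    ∃ n, n ≤ m ∧ (-1 : ℝ) ^ n = (-1) ^ M ∧ (a n = μ ∨ (1 ≤ n ∧ b n = μ)) := by
  have P := jac_pot J m
  have hσ : ((-1 : ℝ) ^ M = 1 ∨ (-1 : ℝ) ^ M = -1) := neg_one_pow_eq_or ℝ M
  have hσ2 : (-1 : ℝ) ^ M * (-1) ^ M = 1 := by rcases hσ with h | h <;> rw [h] <;> norm_num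
  have hform : ∀ (r : ℝ[X]) x, x ∈ Ioo (-K) K → (d x ^ ε * c x ^ M * r.eval (s x / c x)) ^ 2 =
      c x ^ (2 * m) * ((1 + C (1 - k ^ 2) * X ^ 2) ^ ε * r ^ 2).eval (s x / c x) := by
    intro r x hx
    have dt := J.d_t (J.c_pos x hx.1 hx.2).ne'
    simp only [eval_mul, eval_add, eval_pow, eval_C, eval_X, eval_one]
    rw [mul_pow, mul_pow, ← pow_mul, mul_comm ε 2, pow_mul, dt, ← hM, mul_pow (c x ^ 2)]
    generalize (1 + (1 - k ^ 2) * (s x / c x) ^ 2) = D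
    ring
  have hne : ∀ r : ℝ[X], r ≠ 0 → (1 + C (1 - k ^ 2) * X ^ 2) ^ ε * r ^ 2 ≠ 0 := by
    intro r hr
    refine mul_ne_zero (pow_ne_zero _ ?_) (pow_ne_zero _ hr)
    intro h0
    have := congrArg (eval 0) h0
    simp at this
  have hdeg : ∀ r : ℝ[X], r.natDegree ≤ M → ((1 + C (1 - k ^ 2) * X ^ 2) ^ ε * r ^ 2).natDegree ≤ 2 * m := by
    intro r hr
    have h1 : ((1 + C (1 - k ^ 2) * X ^ 2 : ℝ[X]) ^ ε).natDegree ≤ ε * 2 :=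
      natDegree_pow_le_of_le _ (by compute_degree)
    have h2 : (r ^ 2).natDegree ≤ 2 * M := natDegree_pow_le_of_le _ hr
    exact natDegree_mul_le.trans (by omega)
  by_cases hu0 : u 0 = 0
  · have hz0 : z 0 ≠ 0 := by
      intro hz0
      refine hp (J.poly_zero p (fun x hx => ?_))
      have h1 := (h.sol.zero_of P.cont hu0 hz0 x).1
      have hc := J.c_pos x hx.1 hx.2
      have hd := J.dpos x
      rw [h.form x hx] at h1
      exact (mul_eq_zero.1 h1).resolve_left (by positivity)
    obtain ⟨y, y', hy⟩ := O.exD μ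
    have hyu : ∀ x, z 0 * y x = u x := fun x =>
      ((hy.1.smul (z 0)).uniq P.cont h.sol (x₀ := 0) (by rw [hy.2.1, hu0]; ring) (by rw [hy.2.2]; ring) x).1
    obtain ⟨n, hn1, hb, hs⟩ := O.ofD μ y y' _ hy hσ (fun x => by
      apply mul_left_cancel₀ hz0
      rw [hyu, h.per, ← hyu]; ring)
    subst hb
    obtain ⟨S, hS, hS2⟩ := O.zeroD n y y' hn1 hy
    refine ⟨n, lemmaZ J hy.1.1 hS hS2 (hne p hp) (hdeg p h.deg) (z 0 ^ 2) (fun x hx => ?_), hs.symm, Or.inr ⟨hn1, rfl⟩⟩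
    rw [← hform p x hx, ← h.form x hx, ← hyu]; ring
  · obtain ⟨y, y', hy⟩ := O.exN μ
    have hyu : ∀ x, (2 * u 0) * y x = u x + u (-x) := fun x => by
      have hr := h.sol.reflect 0 (fun x => by rw [zero_sub, P.even])
      have := ((hy.1.smul (2 * u 0)).uniq P.cont (h.sol.lin hr 1 1) (x₀ := 0)
        (by rw [hy.2.1, sub_zero]; ring) (by rw [hy.2.2, sub_zero]; ring) x).1
      rw [this, zero_sub]; ring
    have h2u : 2 * u 0 ≠ 0 := by simpa using hu0
    have hper' : ∀ x, u (-(x + 2 * K)) = (-1) ^ M * u (-x) := fun x => by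
      have := h.per (-(x + 2 * K))
      rw [show -(x + 2 * K) + 2 * K = -x by ring] at this
      rw [this, ← mul_assoc, hσ2, one_mul]
    obtain ⟨n, hb, hs⟩ := O.ofN μ y y' _ hy hσ (fun x => by
      apply mul_left_cancel₀ h2u
      rw [hyu, h.per, hper', ← mul_add, ← hyu]; ring)
    subst hb
    obtain ⟨S, hS, hS2⟩ := O.zeroN n y y' hy
    have h0mem : (0 : ℝ) ∈ Ioo (-K) K := ⟨by linarith [J.Kpos], J.Kpos⟩
    have hs0 : s 0 = 0 := by have := J.s_odd 0; simp at this; linarith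
    have hr0 : p + p.comp (-X) ≠ 0 := by
      intro h0
      have h1 := congrArg (eval 0) h0
      have h2 := h.form 0 h0mem
      simp only [eval_add, eval_comp, eval_neg, eval_X, neg_zero, eval_zero] at h1
      rw [hs0, zero_div] at h2
      apply hu0
      rw [h2, show eval 0 p = 0 by linarith, mul_zero]
    have hrd : (p + p.comp (-X)).natDegree ≤ M := by
      refine natDegree_add_le_of_degree_le h.deg ?_
      rw [natDegree_comp]; simpa using h.deg
    refine ⟨n, lemmaZ J hy.1.1 hS hS2 (hne _ hr0) (hdeg _ hrd) ((2 * u 0) ^ 2) (fun x hx => ?_), hs.symm, Or.inl rfl⟩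
    rw [← hform _ x hx, ← mul_pow, hyu]
    have hmx : -x ∈ Ioo (-K) K := ⟨by linarith [hx.2], by linarith [hx.1]⟩
    rw [h.form x hx, h.form (-x) hmx, J.s_odd, J.c_even, J.d_even]
    simp only [eval_add, eval_comp, eval_neg, eval_X, neg_div]
    ring

lemma open_gap {k K : ℝ} {s c d : ℝ → ℝ} (J : Jac k K s c d) {m : ℕ} {a b : ℕ → ℝ}
    (O : Osc (lamePot m k s) K a b) {n : ℕ} (hn1 : 1 ≤ n) (hn : n ≤ m) : a n ≠ b n := by
  classical
  intro hab
  have hq := (jac_pot J m).cont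
  obtain ⟨M, hM⟩ : ∃ M, M + 1 = m := ⟨m - 1, by omega⟩
  obtain ⟨μ0, v0, h01, h02, h03⟩ := lam_eig m (0 : ℝ) J.hk0 J.hk1
  obtain ⟨μ1, v1, h11, h12, h13⟩ := lam_eig M (1 : ℝ) J.hk0 J.hk1
  have hpol : ∀ (N : ℕ) (v : ℕ → ℝ), (∃ j, j ≤ N ∧ v j ≠ 0) → sPol N v ≠ 0 := by
    rintro N v ⟨j, hj, hv⟩ h0
    apply hv
    rw [← sPol_coeff N v hj, h0, coeff_zero]
  have hind : ∀ (N : ℕ) (v v' : ℕ → ℝ), (∀ α β : ℝ, (∀ j, j ≤ N → α * v j + β * v' j = 0) → α = 0 ∧ β = 0) →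
      ∀ α β : ℝ, C α * sPol N v + C β * sPol N v' = 0 → α = 0 ∧ β = 0 := by
    intro N v v' h α β h0
    refine h α β (fun j hj => ?_)
    have := congrArg (fun r => coeff r j) h0
    simpa only [coeff_add, coeff_C_mul, sPol_coeff N _ hj, coeff_zero] using this
  have inj0 : Function.Injective μ0 := by
    intro i i' hii
    by_contra hne
    obtain ⟨u, z, hu⟩ := lam0 J m (v0 i) (h01 i)
    obtain ⟨u', z', hu'⟩ := lam0 J m (v0 i') (h01 i')
    rw [← hii] at hu'
    exact hu.indep J hq hu' (hind _ _ _ (h02 i i' hne))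
  have inj1 : Function.Injective μ1 := by
    intro i i' hii
    by_contra hne
    obtain ⟨u, z, hu⟩ := lam1 J hM (v1 i) (h11 i)
    obtain ⟨u', z', hu'⟩ := lam1 J hM (v1 i') (h11 i')
    rw [← hii] at hu'
    exact hu.indep J hq hu' (hind _ _ _ (h12 i i' hne))
  have idx0 : ∀ i, ∃ n, n ≤ m ∧ (-1 : ℝ) ^ n = (-1) ^ m ∧ (a n = μ0 i ∨ (1 ≤ n ∧ b n = μ0 i)) := by
    intro i
    obtain ⟨u, z, hu⟩ := lam0 J m (v0 i) (h01 i)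
    exact hu.index J O (by omega) (hpol _ _ (h03 i))
  have idx1 : ∀ i, ∃ n, n ≤ m ∧ (-1 : ℝ) ^ n = (-1) ^ M ∧ (a n = μ1 i ∨ (1 ≤ n ∧ b n = μ1 i)) := by
    intro i
    obtain ⟨u, z, hu⟩ := lam1 J hM (v1 i) (h11 i)
    exact hu.index J O hM (hpol _ _ (h13 i))
  have b_inj : ∀ i j, 1 ≤ i → 1 ≤ j → b i = b j → i = j := by
    intro i j hi hj h
    rcases lt_trichotomy i j with h1 | h1 | h1
    · have := O.bb i hi; have := O.b_mono (by omega) (show i + 1 ≤ j from h1); linarith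
    · exact h1
    · have := O.bb j hj; have := O.b_mono (by omega) (show j + 1 ≤ i from h1); linarith
  have disj : ∀ i j, μ0 i ≠ μ1 j := by
    intro i j hij
    obtain ⟨p, -, hp2, hp3⟩ := idx0 i
    obtain ⟨r, -, hr2, hr3⟩ := idx1 j
    have hpr : p = r := by
      rw [← hij] at hr3
      rcases hp3 with hp3 | ⟨hp1, hp3⟩ <;> rcases hr3 with hr3 | ⟨hr1, hr3⟩
      · exact O.a_mono.injective (hp3.trans hr3.symm)
      · exact O.a_eq_b hr1 (hp3.trans hr3.symm)
      · exact (O.a_eq_b hp1 (hr3.trans hp3.symm)).symm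
      · exact b_inj _ _ hp1 hr1 (hp3.trans hr3.symm)
    rw [hpr, hr2, ← hM, pow_succ] at hp2
    have : (-1 : ℝ) ^ M ≠ 0 := pow_ne_zero _ (by norm_num)
    apply this; linarith
  let T : Finset ℝ := (Finset.range (m + 1)).image a ∪ ((Finset.Icc 1 m).erase n).image b
  have hT : T.card ≤ 2 * m := by
    refine (Finset.card_union_le _ _).trans ?_
    have h1 : ((Finset.range (m + 1)).image a).card ≤ m + 1 := Finset.card_image_le.trans (by simp)
    have h2 : (((Finset.Icc 1 m).erase n).image b).card ≤ m - 1 := by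
      refine Finset.card_image_le.trans ?_
      rw [Finset.card_erase_of_mem (Finset.mem_Icc.2 ⟨hn1, hn⟩)]; simp
    omega
  have hmem : ∀ l r, r ≤ m → (a r = l ∨ (1 ≤ r ∧ b r = l)) → l ∈ T := by
    rintro l r hr (rfl | ⟨h1, rfl⟩)
    · exact Finset.mem_union_left _ (Finset.mem_image_of_mem _ (by simp; omega))
    · by_cases hrn : r = n
      · subst hrn
        rw [← hab]
        exact Finset.mem_union_left _ (Finset.mem_image_of_mem _ (by simp; omega))
      · exact Finset.mem_union_right _ (Finset.mem_image_of_mem _ (by simp; omega))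
  let U : Finset ℝ := Finset.univ.image μ0 ∪ Finset.univ.image μ1
  have hU : U.card = (m + 1) + (M + 1) := by
    rw [Finset.card_union_of_disjoint, Finset.card_image_of_injective _ inj0, Finset.card_image_of_injective _ inj1]
    · simp
    · rw [Finset.disjoint_left]
      intro l h1 h2
      obtain ⟨i, -, rfl⟩ := Finset.mem_image.1 h1
      obtain ⟨j, -, hj⟩ := Finset.mem_image.1 h2
      exact disj i j hj.symm
  have hUT : U ⊆ T := by
    intro l hl
    rcases Finset.mem_union.1 hl with hl | hl
    · obtain ⟨i, -, rfl⟩ := Finset.mem_image.1 hl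
      obtain ⟨r, h1, -, h2⟩ := idx0 i
      exact hmem _ r h1 h2
    · obtain ⟨i, -, rfl⟩ := Finset.mem_image.1 hl
      obtain ⟨r, h1, -, h2⟩ := idx1 i
      exact hmem _ r h1 h2
  have := Finset.card_le_card hUT
  omega

end

lemma toSol {q : ℝ → ℝ} {T l σ : ℝ} {ψ : ℝ → ℝ} (h : IsFloquetSolution q T l σ ψ) :
    IsSol q l ψ (deriv ψ) := by
  obtain ⟨-, h1, h2, -⟩ := h
  have h3 : ContDiff ℝ 1 (deriv ψ) :=
    ((contDiff_succ_iff_deriv (n := 1) (f := ψ)).1 (by rw [one_add_one_eq_two]; exact h1)).2.2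
  refine ⟨fun x => (h1.differentiable (by norm_num) x).hasDerivAt, fun x => ?_⟩
  refine (h3.differentiable (by norm_num) x).hasDerivAt.congr_deriv ?_
  linarith [h2 x]

lemma ofSol {q : ℝ → ℝ} (hq : Continuous q) {T l σ : ℝ} {y z : ℝ → ℝ} (h : IsSol q l y z)
    (h0 : y 0 ≠ 0 ∨ z 0 ≠ 0) (hp : ∀ x, y (x + T) = σ * y x) : IsFloquetSolution q T l σ y := by
  have hdy : deriv y = z := funext fun x => (h.1 x).deriv
  have hdz : deriv z = fun x => (q x - l) * y x := funext fun x => (h.2 x).deriv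
  have hyc : Continuous y := continuous_iff_continuousAt.2 fun x => (h.1 x).continuousAt
  refine ⟨?_, ?_, ?_, hp⟩
  · rintro rfl
    rcases h0 with h0 | h0
    · exact h0 rfl
    · exact h0 ((h.1 0).unique (hasDerivAt_const (0 : ℝ) (0 : ℝ)))
  · have h1 : ContDiff ℝ 1 z := by
      rw [contDiff_one_iff_deriv, hdz]
      exact ⟨fun x => (h.2 x).differentiableAt, by fun_prop⟩
    rw [← one_add_one_eq_two, contDiff_succ_iff_deriv, hdy]
    exact ⟨fun x => (h.1 x).differentiableAt, by simp, h1⟩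
  · intro x
    rw [hdy, hdz]; ring

section
variable {q : ℝ → ℝ} {K B : ℝ} {a b : ℕ → ℝ}

lemma floq_a (P : Pot q K B) (O : Osc q K a b) (n : ℕ) :
    ∃ ψ, IsFloquetSolution q (2 * K) (a n) ((-1) ^ n) ψ := by
  obtain ⟨y, z, h⟩ := O.exN (a n)
  exact ⟨y, ofSol P.cont h.1 (Or.inl (by rw [h.2.1]; norm_num)) (O.perN n y z h)⟩

lemma floq_b (P : Pot q K B) (O : Osc q K a b) {n : ℕ} (hn : 1 ≤ n) :
    ∃ ψ, IsFloquetSolution q (2 * K) (b n) ((-1) ^ n) ψ := by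
  obtain ⟨y, z, h⟩ := O.exD (b n)
  exact ⟨y, ofSol P.cont h.1 (Or.inr (by rw [h.2.2]; norm_num)) (O.perD n y z hn h)⟩

lemma floq_cases (P : Pot q K B) (O : Osc q K a b) {l σ : ℝ} (hσ : σ = 1 ∨ σ = -1) {ψ : ℝ → ℝ}
    (h : IsFloquetSolution q (2 * K) l σ ψ) : ∃ n, σ = (-1) ^ n ∧ (a n = l ∨ (1 ≤ n ∧ b n = l)) := by
  have hs := toSol h
  obtain ⟨hne, -, -, hper⟩ := h
  have hσ2 : σ * σ = 1 := by rcases hσ with h | h <;> rw [h] <;> norm_num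
  by_cases hu0 : ψ 0 = 0
  · have hz0 : deriv ψ 0 ≠ 0 := by
      intro hz0
      exact hne (funext fun x => (hs.zero_of P.cont hu0 hz0 x).1)
    obtain ⟨y, y', hy⟩ := O.exD l
    have hyu : ∀ x, deriv ψ 0 * y x = ψ x := fun x =>
      ((hy.1.smul (deriv ψ 0)).uniq P.cont hs (x₀ := 0) (by rw [hy.2.1, hu0]; ring) (by rw [hy.2.2]; ring) x).1
    obtain ⟨n, hn1, hb, hs⟩ := O.ofD l y y' _ hy hσ (fun x => by
      apply mul_left_cancel₀ hz0
      rw [hyu, hper, ← hyu]; ring)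
    exact ⟨n, hs, Or.inr ⟨hn1, hb⟩⟩
  · obtain ⟨y, y', hy⟩ := O.exN l
    have hyu : ∀ x, (2 * ψ 0) * y x = ψ x + ψ (-x) := fun x => by
      have hr := hs.reflect 0 (fun x => by rw [zero_sub, P.even])
      have := ((hy.1.smul (2 * ψ 0)).uniq P.cont (hs.lin hr 1 1) (x₀ := 0)
        (by rw [hy.2.1, sub_zero]; ring) (by rw [hy.2.2, sub_zero]; ring) x).1
      rw [this, zero_sub]; ring
    have h2u : 2 * ψ 0 ≠ 0 := by simpa using hu0
    have hper' : ∀ x, ψ (-(x + 2 * K)) = σ * ψ (-x) := fun x => by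
      have := hper (-(x + 2 * K))
      rw [show -(x + 2 * K) + 2 * K = -x by ring] at this
      rw [this, ← mul_assoc, hσ2, one_mul]
    obtain ⟨n, hb, hs⟩ := O.ofN l y y' _ hy hσ (fun x => by
      apply mul_left_cancel₀ h2u
      rw [hyu, hper, hper', ← mul_add, ← hyu]; ring)
    exact ⟨n, hs, Or.inl hb⟩

lemma double_iff (P : Pot q K B) (O : Osc q K a b) {l σ : ℝ} (hσ : σ = 1 ∨ σ = -1) :
    (∃ ψ₁ ψ₂ : ℝ → ℝ, LinearIndependent ℝ ![ψ₁, ψ₂] ∧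
      IsFloquetSolution q (2 * K) l σ ψ₁ ∧ IsFloquetSolution q (2 * K) l σ ψ₂) ↔
    ∃ n, 1 ≤ n ∧ σ = (-1) ^ n ∧ a n = l ∧ b n = l := by
  constructor
  · rintro ⟨f, g, hli, hf, hg⟩
    have key : ∀ α β : ℝ, (∀ x, α * f x + β * g x = 0) → α = 0 ∧ β = 0 := fun α β h =>
      LinearIndependent.pair_iff.1 hli α β (funext fun x => by simpa using h x)
    have sf := toSol hf
    have sg := toSol hg
    generalize deriv f = f' at sf
    generalize deriv g = g' at sg
    have hD : f 0 * g' 0 - f' 0 * g 0 ≠ 0 := by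
      intro hw
      have h1 := key (g 0) (-f 0) (fun x => ((sf.lin sg (g 0) (-f 0)).zero_of P.cont (x₀ := 0)
        (by ring) (by linarith) x).1)
      have h2 := key (g' 0) (-f' 0) (fun x => ((sf.lin sg (g' 0) (-f' 0)).zero_of P.cont (x₀ := 0)
        (by linarith) (by ring) x).1)
      have h3 := key 1 0 (fun x => by
        rw [(sf.zero_of P.cont (x₀ := 0) (by linarith [h1.2]) (by linarith [h2.2]) x).1]; ring)
      exact one_ne_zero h3.1
    obtain ⟨y, y', hy⟩ := O.exN l
    obtain ⟨w, w', hw⟩ := O.exD l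
    have ey : ∀ x, (f 0 * g' 0 - f' 0 * g 0) * y x = g' 0 * f x + (-f' 0) * g x := fun x =>
      ((hy.1.smul _).uniq P.cont (sf.lin sg (g' 0) (-f' 0)) (x₀ := 0) (by rw [hy.2.1]; ring)
        (by rw [hy.2.2]; ring) x).1
    have ew : ∀ x, (f 0 * g' 0 - f' 0 * g 0) * w x = (-g 0) * f x + f 0 * g x := fun x =>
      ((hw.1.smul _).uniq P.cont (sf.lin sg (-g 0) (f 0)) (x₀ := 0) (by rw [hw.2.1]; ring)
        (by rw [hw.2.2]; ring) x).1
    obtain ⟨i, hi, hi2⟩ := O.ofN l y y' σ hy hσ (fun x => by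
      apply mul_left_cancel₀ hD
      rw [ey, hf.2.2.2, hg.2.2.2]
      linear_combination (-σ) * ey x)
    obtain ⟨j, hj1, hj, -⟩ := O.ofD l w w' σ hw hσ (fun x => by
      apply mul_left_cancel₀ hD
      rw [ew, hf.2.2.2, hg.2.2.2]
      linear_combination (-σ) * ew x)
    have := O.a_eq_b hj1 (hi.trans hj.symm)
    subst this
    exact ⟨i, hj1, hi2, hi, hj⟩
  · rintro ⟨n, hn, rfl, ha, hb⟩
    obtain ⟨y, y', hy⟩ := O.exN l
    obtain ⟨w, w', hw⟩ := O.exD l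
    refine ⟨y, w, ?_, ofSol P.cont hy.1 (Or.inl (by rw [hy.2.1]; norm_num)) (O.perN n y y' (by rw [ha]; exact hy)),
      ofSol P.cont hw.1 (Or.inr (by rw [hw.2.2]; norm_num)) (O.perD n w w' hn (by rw [hb]; exact hw))⟩
    rw [LinearIndependent.pair_iff]
    intro α β h
    have h1 := hy.1.lin hw.1 α β
    have h2 : (fun x => α * y x + β * w x) = fun _ => 0 := funext fun x => by
      simpa using congrFun h x
    have e1 := congrFun h2 0
    have e2 := h1.1 0
    rw [h2] at e2
    have e3 := e2.unique (hasDerivAt_const (0 : ℝ) (0 : ℝ))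
    simp only [hy.2.1, hw.2.1, hy.2.2, hw.2.2] at e1 e3
    constructor <;> linarith

lemma double_min (P : Pot q K B) (O : Osc q K a b) {σ : ℝ} (hσ : σ = 1 ∨ σ = -1) {r : ℕ} (hr : 1 ≤ r)
    (hr2 : σ = (-1) ^ r) : (min (a r) (b r) = max (a r) (b r)) ↔
    (∃ ψ₁ ψ₂ : ℝ → ℝ, LinearIndependent ℝ ![ψ₁, ψ₂] ∧
      IsFloquetSolution q (2 * K) (min (a r) (b r)) σ ψ₁ ∧ IsFloquetSolution q (2 * K) (min (a r) (b r)) σ ψ₂) := by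
  rw [double_iff P O hσ]
  constructor
  · intro h
    have h2 : a r = b r := by
      by_contra hne
      exact absurd h (min_lt_max.2 hne).ne
    exact ⟨r, hr, hr2, by rw [h2, min_self], by rw [h2, min_self]⟩
  · rintro ⟨n, hn, -, h1, h2⟩
    have : n = r := by
      rcases min_choice (a r) (b r) with h | h
      · exact O.a_mono.injective (h1.trans h)
      · exact O.a_eq_b hr (h1.trans h)
    subst this
    rw [h1.trans h2.symm, min_self, max_self]

end

/-- The spectrum of the Lamé operator
`L_m = -d²/dx² + m(m+1)k² sn²(x,k)` (with `0 < k < 1`, `m ≥ 1`) has a band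
structure with exactly `m` open gaps, and these are precisely the *first* `m`
gaps: there are sequences `λ₀ < λ'₁ ≤ λ'₂ < λ₁ ≤ λ₂ < λ'₃ ≤ ⋯ → ∞` of periodic
(`λⱼ`) and antiperiodic (`λ'ⱼ`) eigenvalues enumerating the whole periodic and
antiperiodic spectra, whose consecutive pairs bound the spectral gaps, such
that a gap coincides with a coexistence point (closed gap) exactly when its two
endpoints agree, and the `n`-th gap (in increasing order: the `(2j-1)`-st gap
is `(λ'_{2j-1}, λ'_{2j})`, the `2j`-th gap is `(λ_{2j-1}, λ_{2j})`) is open if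
and only if `n ≤ m`. In particular every closed gap lies in the infinite
spectral band above the `m`-th gap. -/
theorem lame_first_m_gaps_open
    (m : ℕ) (hm : 1 ≤ m) (k : ℝ) (hk : k ∈ Set.Ioo (0:ℝ) 1)
    (sn : ℝ → ℝ) (hsn : IsJacobiSn k sn) :
    ∃ lam lam' : ℕ → ℝ,
      -- λⱼ are 2K-periodic eigenvalues, λ'ⱼ (j ≥ 1) are 2K-antiperiodic ones
      (∀ j : ℕ, IsPeriodicEV (lamePot m k sn) (2 * ellK k) (lam j)) ∧
      (∀ j : ℕ, 1 ≤ j → IsAntiperiodicEV (lamePot m k sn) (2 * ellK k) (lam' j)) ∧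
      -- they enumerate the whole periodic and antiperiodic spectra
      (∀ x : ℝ, IsPeriodicEV (lamePot m k sn) (2 * ellK k) x → ∃ j, lam j = x) ∧
      (∀ x : ℝ, IsAntiperiodicEV (lamePot m k sn) (2 * ellK k) x →
        ∃ j, 1 ≤ j ∧ lam' j = x) ∧
      -- interlacing (oscillation theorem):
      -- λ₀ < λ'₁ ≤ λ'₂ < λ₁ ≤ λ₂ < λ'₃ ≤ λ'₄ < λ₃ ≤ λ₄ < ⋯
      (∀ n : ℕ, 1 ≤ n →
        lam (2 * n - 2) < lam' (2 * n - 1) ∧ lam' (2 * n - 1) ≤ lam' (2 * n) ∧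
        lam' (2 * n) < lam (2 * n - 1) ∧ lam (2 * n - 1) ≤ lam (2 * n)) ∧
      Filter.Tendsto lam Filter.atTop Filter.atTop ∧
      -- a gap is closed exactly at a coexistence point
      (∀ n : ℕ, 1 ≤ n → (lam (2 * n - 1) = lam (2 * n) ↔
        IsDoublePeriodicEV (lamePot m k sn) (2 * ellK k) (lam (2 * n - 1)))) ∧
      (∀ n : ℕ, 1 ≤ n → (lam' (2 * n - 1) = lam' (2 * n) ↔
        IsDoubleAntiperiodicEV (lamePot m k sn) (2 * ellK k) (lam' (2 * n - 1)))) ∧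
      -- the open gaps are precisely the first m gaps
      (∀ n : ℕ, 1 ≤ n →
        (lam' (2 * n - 1) < lam' (2 * n) ↔ 2 * n - 1 ≤ m) ∧
        (lam (2 * n - 1) < lam (2 * n) ↔ 2 * n ≤ m)) := by

  obtain ⟨s, c, d, J⟩ := jac_exists hk.1 hk.2
  obtain rfl := jac_sn J hsn
  have P := jac_pot J m
  obtain ⟨a, b, O⟩ := osc_exists P
  generalize ellK k = K at J P O
  have hop : ∀ n, 1 ≤ n → (min (a n) (b n) < max (a n) (b n) ↔ n ≤ m) := by
    intro n hn
    rw [min_lt_max]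
    refine ⟨fun h => ?_, fun h => open_gap J O hn h⟩
    by_contra hcon
    exact h (closed_gap J O (by omega))
  have hgh : ∀ n, 1 ≤ n → max (a n) (b n) < min (a (n + 1)) (b (n + 1)) := fun n hn =>
    max_lt (lt_min (O.aa n) (O.ab n)) (lt_min (O.ba n hn) (O.bb n hn))
  let lam : ℕ → ℝ := fun j => if j = 0 then a 0 else if Even j then max (a j) (b j)
    else min (a (j + 1)) (b (j + 1))
  let lam' : ℕ → ℝ := fun j => if Even j then max (a (j - 1)) (b (j - 1)) else min (a j) (b j)
  have l0 : lam 0 = a 0 := if_pos rfl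
  have le : ∀ N, lam (2 * N + 2) = max (a (2 * N + 2)) (b (2 * N + 2)) := fun N => by
    have : Even (2 * N + 2) := ⟨N + 1, by ring⟩
    simp only [lam]; rw [if_neg (by omega), if_pos this]
  have lo : ∀ N, lam (2 * N + 1) = min (a (2 * N + 2)) (b (2 * N + 2)) := fun N => by
    have : ¬ Even (2 * N + 1) := by rw [Nat.not_even_iff_odd]; exact ⟨N, rfl⟩
    simp only [lam]; rw [if_neg (by omega), if_neg this]
  have le' : ∀ N, lam' (2 * N + 2) = max (a (2 * N + 1)) (b (2 * N + 1)) := fun N => by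
    have : Even (2 * N + 2) := ⟨N + 1, by ring⟩
    simp only [lam']; rw [if_pos this]; rfl
  have lo' : ∀ N, lam' (2 * N + 1) = min (a (2 * N + 1)) (b (2 * N + 1)) := fun N => by
    have : ¬ Even (2 * N + 1) := by rw [Nat.not_even_iff_odd]; exact ⟨N, rfl⟩
    simp only [lam']; rw [if_neg this]
  clear_value lam lam'
  have pe : ∀ N : ℕ, (1 : ℝ) = (-1) ^ (2 * N + 2) := fun N => by
    rw [show 2 * N + 2 = 2 * (N + 1) by ring, pow_mul]; norm_num
  have po : ∀ N : ℕ, (-1 : ℝ) = (-1) ^ (2 * N + 1) := fun N => by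
    rw [pow_succ, pow_mul]; norm_num
  have split : ∀ j : ℕ, j = 0 ∨ (∃ N, j = 2 * N + 1) ∨ ∃ N, j = 2 * N + 2 := by
    intro j
    rcases Nat.even_or_odd' j with ⟨N, h | h⟩
    · rcases N with _ | N
      · left; omega
      · right; right; exact ⟨N, by omega⟩
    · right; left; exact ⟨N, h⟩
  have fmin : ∀ r, 1 ≤ r → ∃ ψ, IsFloquetSolution (lamePot m k sn) (2 * K) (min (a r) (b r)) ((-1) ^ r) ψ := by
    intro r hr
    rcases min_choice (a r) (b r) with h | h <;> rw [h]
    · exact floq_a P O r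
    · exact floq_b P O hr
  have fmax : ∀ r, 1 ≤ r → ∃ ψ, IsFloquetSolution (lamePot m k sn) (2 * K) (max (a r) (b r)) ((-1) ^ r) ψ := by
    intro r hr
    rcases max_choice (a r) (b r) with h | h <;> rw [h]
    · exact floq_a P O r
    · exact floq_b P O hr
  have mm : ∀ r x, (a r = x ∨ (1 ≤ r ∧ b r = x)) → min (a r) (b r) = x ∨ max (a r) (b r) = x := by
    intro r x h
    rcases le_total (a r) (b r) with h1 | h1
    · rw [min_eq_left h1, max_eq_right h1]; tauto
    · rw [min_eq_right h1, max_eq_left h1]; tauto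
  refine ⟨lam, lam', fun j => ?_, fun j hj => ?_, fun x hx => ?_, fun x hx => ?_, fun n hn => ?_, ?_,
    fun n hn => ?_, fun n hn => ?_, fun n hn => ?_⟩
  · rcases split j with rfl | ⟨N, rfl⟩ | ⟨N, rfl⟩
    · rw [l0, IsPeriodicEV]; simpa using floq_a P O 0
    · rw [lo, IsPeriodicEV, pe N]; exact fmin _ (by omega)
    · rw [le, IsPeriodicEV, pe N]; exact fmax _ (by omega)
  · rcases split j with rfl | ⟨N, rfl⟩ | ⟨N, rfl⟩
    · omega
    · rw [lo', IsAntiperiodicEV, po N]; exact fmin _ (by omega)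
    · rw [le', IsAntiperiodicEV, po N]; exact fmax _ (by omega)
  · obtain ⟨ψ, hψ⟩ := hx
    obtain ⟨n, h1, h2⟩ := floq_cases P O (Or.inl rfl) hψ
    rcases split n with rfl | ⟨N, rfl⟩ | ⟨N, rfl⟩
    · refine ⟨0, ?_⟩
      rcases h2 with h2 | h2
      · rw [l0, h2]
      · omega
    · rw [← po N] at h1; norm_num at h1
    · rcases mm _ _ h2 with h | h
      · exact ⟨2 * N + 1, by rw [lo, h]⟩
      · exact ⟨2 * N + 2, by rw [le, h]⟩
  · obtain ⟨ψ, hψ⟩ := hx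
    obtain ⟨n, h1, h2⟩ := floq_cases P O (Or.inr rfl) hψ
    rcases split n with rfl | ⟨N, rfl⟩ | ⟨N, rfl⟩
    · norm_num at h1
    · rcases mm _ _ h2 with h | h
      · exact ⟨2 * N + 1, by omega, by rw [lo', h]⟩
      · exact ⟨2 * N + 2, by omega, by rw [le', h]⟩
    · rw [← pe N] at h1; norm_num at h1
  · obtain ⟨N, rfl⟩ := Nat.exists_eq_add_of_le' hn
    rw [show 2 * (N + 1) - 2 = 2 * N by omega, show 2 * (N + 1) - 1 = 2 * N + 1 by omega,
      show 2 * (N + 1) = 2 * N + 2 by ring, le, lo, le', lo']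
    refine ⟨?_, min_le_max, hgh (2 * N + 1) (by omega), min_le_max⟩
    rcases N with _ | N
    · rw [mul_zero, l0]; exact lt_min (O.aa 0) (O.ab 0)
    · rw [show 2 * (N + 1) = 2 * N + 2 by ring, le]
      exact hgh (2 * N + 2) (by omega)
  · refine tendsto_atTop_mono (fun j => ?_) O.tend
    rcases split j with rfl | ⟨N, rfl⟩ | ⟨N, rfl⟩
    · rw [l0]
    · rw [lo]; exact le_min (O.aa _).le (O.ab _).le
    · rw [le]; exact le_max_left _ _
  · obtain ⟨N, rfl⟩ := Nat.exists_eq_add_of_le' hn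
    rw [show 2 * (N + 1) - 1 = 2 * N + 1 by omega, show 2 * (N + 1) = 2 * N + 2 by ring, le, lo]
    exact double_min P O (Or.inl rfl) (by omega) (pe N)
  · obtain ⟨N, rfl⟩ := Nat.exists_eq_add_of_le' hn
    rw [show 2 * (N + 1) - 1 = 2 * N + 1 by omega, show 2 * (N + 1) = 2 * N + 2 by ring, le', lo']
    exact double_min P O (Or.inr rfl) (by omega) (po N)
  · obtain ⟨N, rfl⟩ := Nat.exists_eq_add_of_le' hn
    rw [show 2 * (N + 1) - 1 = 2 * N + 1 by omega, show 2 * (N + 1) = 2 * N + 2 by ring, le, lo, le', lo']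
    exact ⟨hop _ (by omega), hop _ (by omega)⟩
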